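/- arXiv:1705.07392 — 6 statements merged into one kernel-verified Lean document; each statement's English description precedes it below -/
import Mathlib

section
/- For all real numbers f, k, l, Ω and c ≠ 0, the determinant of the 3×3 matrix with rows (l, −2k, −f), (k + (Ω/c)l, f + (Ω²/c²)l, (Ω/c)(f − (Ω/c)k)), (1, 2Ω/c, Ω²/c²) equals (f − 2(Ω/c)k − (Ω²/c²)l)², i.e. Δ = (f')² where f' := f − 2(Ω/c)k − (Ω²/c²)l. -/
/-- The determinant Δ of the 3×3 matrix of the linear system equals (f')². -/
theorem det_linear_system_eq_fprime_sq
    (f k l Ω c : ℝ) (hc : c ≠ 0) :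
    Matrix.det
      !![l, -2 * k, -f;
         k + (Ω / c) * l, f + (Ω ^ 2 / c ^ 2) * l, (Ω / c) * (f - (Ω / c) * k);
         1, 2 * Ω / c, Ω ^ 2 / c ^ 2]
      = (f - 2 * (Ω / c) * k - (Ω ^ 2 / c ^ 2) * l) ^ 2 := by
  rw [Matrix.det_fin_three]
  simp only [Matrix.of_apply, Matrix.cons_val]
  ring
end

section
/- With F' and A' defined from F, A, Π as stated, the following two identities hold: e^{2F'}·A'² − e^{−2F'}·Π² = e^{2F}·A² − e^{−2F}·Π², and (1 − (Ω/c)A')·e^{2F'} = (1 + (Ω/c)A)·e^{2F}. -/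
/-- The identities verified in passing to the corotating coordinate system:
e^{2F'}A'² − e^{−2F'}Π² = e^{2F}A² − e^{−2F}Π² and
(1 − (Ω/c)A')e^{2F'} = (1 + (Ω/c)A)e^{2F}  (identity (X8)). -/
theorem corotating_transformation_identities
    (Ω c F A Pi : ℝ) (hc : 0 < c)
    (h : 0 < Real.exp (2 * F) * (1 + (Ω / c) * A) ^ 2
          - Real.exp (-(2 * F)) * (Ω ^ 2 / c ^ 2) * Pi ^ 2) :
    let F' := (1 / 2) * Real.log (Real.exp (2 * F) * (1 + (Ω / c) * A) ^ 2
          - Real.exp (-(2 * F)) * (Ω ^ 2 / c ^ 2) * Pi ^ 2)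
    let A' := Real.exp (-(2 * F')) *
          (Real.exp (2 * F) * (1 + (Ω / c) * A) * A - (Ω / c) * Real.exp (-(2 * F)) * Pi ^ 2)
    Real.exp (2 * F') * A' ^ 2 - Real.exp (-(2 * F')) * Pi ^ 2
        = Real.exp (2 * F) * A ^ 2 - Real.exp (-(2 * F)) * Pi ^ 2
      ∧ (1 - (Ω / c) * A') * Real.exp (2 * F') = (1 + (Ω / c) * A) * Real.exp (2 * F) := by
  intro F' A'
  set D := Real.exp (2 * F) * (1 + (Ω / c) * A) ^ 2
    - Real.exp (-(2 * F)) * (Ω ^ 2 / c ^ 2) * Pi ^ 2 with hD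
  have hF' : Real.exp (2 * F') = D := by
    rw [show 2 * F' = Real.log D by simp only [F']; ring, Real.exp_log h]
  have hFinv : Real.exp (2 * F) * Real.exp (-(2 * F)) = 1 := by
    rw [← Real.exp_add, add_neg_cancel, Real.exp_zero]
  have hA' : D * A' = Real.exp (2 * F) * (1 + (Ω / c) * A) * A
      - (Ω / c) * Real.exp (-(2 * F)) * Pi ^ 2 := by
    simp only [A', Real.exp_neg (2 * F'), hF']
    rw [mul_inv_cancel_left₀ h.ne']
  rw [Real.exp_neg (2 * F'), hF']
  rw [← div_pow] at hD
  refine ⟨?_, by linear_combination hD - (Ω / c) * hA'⟩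
  apply mul_left_cancel₀ h.ne'
  rw [mul_sub, mul_inv_cancel_left₀ h.ne', ← mul_assoc, ← sq, ← mul_pow, hA', hD]
  linear_combination Pi ^ 2 * hFinv
end

section
/- The following identity holds on D for Σ: Σ = [2Π·∂₁Π·(∂₁f'/f') − (Π·∂₁f'/f')² + (f'·∂₁A')²] + [2Π·∂₃Π·(∂₃f'/f') − (Π·∂₃f'/f')² + (f'·∂₃A')²]. -/
open Real

/-- Partial derivative with respect to the first coordinate ϖ. -/
noncomputable def pd1 (f : ℝ × ℝ → ℝ) (x : ℝ × ℝ) : ℝ := fderiv ℝ f x (1, 0)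

/-- Partial derivative with respect to the second coordinate z. -/
noncomputable def pd3 (f : ℝ × ℝ → ℝ) (x : ℝ × ℝ) : ℝ := fderiv ℝ f x (0, 1)

/-- The identity along a single direction `v`, for differentiable functions. -/
theorem fderiv_Sigma_identity {E : Type*} [NormedAddCommGroup E] [NormedSpace ℝ E]
    {f A l : E → ℝ} {x : E} (v : E)
    (hf : DifferentiableAt ℝ f x) (hA : DifferentiableAt ℝ A x) (hl : DifferentiableAt ℝ l x)
    (hf0 : f x ≠ 0) (hpos : 0 < f x * l x + (-(f x * A x)) ^ 2) :
    fderiv ℝ f x v * fderiv ℝ l x v + (fderiv ℝ (fun y => -(f y * A y)) x v) ^ 2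
      = 2 * √(f x * l x + (-(f x * A x)) ^ 2)
            * fderiv ℝ (fun y => √(f y * l y + (-(f y * A y)) ^ 2)) x v * (fderiv ℝ f x v / f x)
          - (√(f x * l x + (-(f x * A x)) ^ 2) * fderiv ℝ f x v / f x) ^ 2
          + (f x * fderiv ℝ A x v) ^ 2 := by
  have hk := (hf.hasFDerivAt.mul hA.hasFDerivAt).fun_neg
  have hP := (hf.hasFDerivAt.mul hl.hasFDerivAt).add (hk.pow 2)
  have hkv : fderiv ℝ (fun y => -(f y * A y)) x v
      = -(f x * fderiv ℝ A x v + A x * fderiv ℝ f x v) := by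
    rw [HasFDerivAt.fderiv (f := fun y => -(f y * A y)) hk]
    simp
  have hsqrt : 2 * √(f x * l x + (-(f x * A x)) ^ 2)
        * fderiv ℝ (fun y => √(f y * l y + (-(f y * A y)) ^ 2)) x v
      = f x * fderiv ℝ l x v + l x * fderiv ℝ f x v
        + 2 * (f x * A x) * (f x * fderiv ℝ A x v + A x * fderiv ℝ f x v) := by
    have hs := (Real.sqrt_pos.2 hpos).ne'
    rw [HasFDerivAt.fderiv (f := fun y => √(f y * l y + (-(f y * A y)) ^ 2))
      (HasFDerivAt.sqrt hP hpos.ne')]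
    set s := √(f x * l x + (-(f x * A x)) ^ 2)
    simp
    field_simp
    ring
  rw [hsqrt, hkv, div_pow, mul_pow, Real.sq_sqrt hpos.le]
  field_simp
  ring

/-- Identity (50): the expression of Σ in terms of f', A' and Π, where
k' = −f'A', Π = √(f'l' + k'²) and
Σ = ∂₁f'·∂₁l' + ∂₃f'·∂₃l' + (∂₁k')² + (∂₃k')². -/
theorem Sigma_identity
    (D : Set (ℝ × ℝ)) (hD : IsOpen D)
    (f' A' l' : ℝ × ℝ → ℝ)
    (hf : ContDiffOn ℝ (⊤ : ℕ∞) f' D) (hA : ContDiffOn ℝ (⊤ : ℕ∞) A' D) (hl : ContDiffOn ℝ (⊤ : ℕ∞) l' D)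
    (hfpos : ∀ x ∈ D, 0 < f' x)
    (hpos : ∀ x ∈ D, 0 < f' x * l' x + (-(f' x * A' x)) ^ 2) :
    ∀ x ∈ D,
      pd1 f' x * pd1 l' x + pd3 f' x * pd3 l' x
        + (pd1 (fun y => -(f' y * A' y)) x) ^ 2 + (pd3 (fun y => -(f' y * A' y)) x) ^ 2
      = (2 * Real.sqrt (f' x * l' x + (-(f' x * A' x)) ^ 2)
            * pd1 (fun y => Real.sqrt (f' y * l' y + (-(f' y * A' y)) ^ 2)) x
            * (pd1 f' x / f' x)
          - (Real.sqrt (f' x * l' x + (-(f' x * A' x)) ^ 2) * pd1 f' x / f' x) ^ 2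
          + (f' x * pd1 A' x) ^ 2)
        + (2 * Real.sqrt (f' x * l' x + (-(f' x * A' x)) ^ 2)
            * pd3 (fun y => Real.sqrt (f' y * l' y + (-(f' y * A' y)) ^ 2)) x
            * (pd3 f' x / f' x)
          - (Real.sqrt (f' x * l' x + (-(f' x * A' x)) ^ 2) * pd3 f' x / f' x) ^ 2
          + (f' x * pd3 A' x) ^ 2) := by
  intro x hx
  have hD' := hD.mem_nhds hx
  have hfd := (hf.contDiffAt hD').differentiableAt (by simp)
  have hAd := (hA.contDiffAt hD').differentiableAt (by simp)
  have hld := (hl.contDiffAt hD').differentiableAt (by simp)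
  have h1 := fderiv_Sigma_identity (1, 0) hfd hAd hld (hfpos x hx).ne' (hpos x hx)
  have h3 := fderiv_Sigma_identity (0, 1) hfd hAd hld (hfpos x hx).ne' (hpos x hx)
  unfold pd1 pd3
  linear_combination h1 + h3
end

section
/- For j = 1 and j = 3 the following identities hold on D: ∂_jf·∂_jl + (∂_jk)² = ∂_jf'·∂_jl' + (∂_jk')² = −4(∂_jF')²·Π² + 4∂_jF'·Π·∂_jΠ + e^{4F'}·(∂_jA')². -/
open Real

/-- f' = f − 2(Ω/c)k − (Ω²/c²)l. -/
noncomputable def fP (Ω c : ℝ) (f k l : ℝ × ℝ → ℝ) (x : ℝ × ℝ) : ℝ :=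
  f x - 2 * (Ω / c) * k x - (Ω ^ 2 / c ^ 2) * l x

/-- Π = √(f·l + k²). -/
noncomputable def PiF (f k l : ℝ × ℝ → ℝ) (x : ℝ × ℝ) : ℝ :=
  Real.sqrt (f x * l x + (k x) ^ 2)

/-- k' = k + (Ω/c)l. -/
noncomputable def kP (Ω c : ℝ) (k l : ℝ × ℝ → ℝ) (x : ℝ × ℝ) : ℝ :=
  k x + (Ω / c) * l x

/-- F' = ½ log f'. -/
noncomputable def FP (Ω c : ℝ) (f k l : ℝ × ℝ → ℝ) (x : ℝ × ℝ) : ℝ :=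
  (1 / 2) * Real.log (fP Ω c f k l x)

/-- A' = −k'/f'. -/
noncomputable def AP (Ω c : ℝ) (f k l : ℝ × ℝ → ℝ) (x : ℝ × ℝ) : ℝ :=
  -(kP Ω c k l x) / fP Ω c f k l x

/-- K' = F' + m/2. -/
noncomputable def KP (Ω c : ℝ) (f k l m : ℝ × ℝ → ℝ) (x : ℝ × ℝ) : ℝ :=
  FP Ω c f k l x + m x / 2

/-- Σ = ∂₁f·∂₁l + ∂₃f·∂₃l + (∂₁k)² + (∂₃k)². -/
noncomputable def SigF (f k l : ℝ × ℝ → ℝ) (x : ℝ × ℝ) : ℝ :=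
  pd1 f x * pd1 l x + pd3 f x * pd3 l x + (pd1 k x) ^ 2 + (pd3 k x) ^ 2

/-- Ricci component R₀₀ of the Lewis metric. -/
noncomputable def R00 (f k l m : ℝ × ℝ → ℝ) (x : ℝ × ℝ) : ℝ :=
  (PiF f k l x * Real.exp (-(m x)) / 2) *
    (pd1 (fun y => pd1 f y / PiF f k l y) x + pd3 (fun y => pd3 f y / PiF f k l y) x
      + f x * SigF f k l x / (PiF f k l x) ^ 3)

/-- Ricci component R₀₂ of the Lewis metric. -/
noncomputable def R02 (f k l m : ℝ × ℝ → ℝ) (x : ℝ × ℝ) : ℝ :=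
  -((PiF f k l x * Real.exp (-(m x)) / 2) *
    (pd1 (fun y => pd1 k y / PiF f k l y) x + pd3 (fun y => pd3 k y / PiF f k l y) x
      + k x * SigF f k l x / (PiF f k l x) ^ 3))

/-- Ricci component R₂₂ of the Lewis metric. -/
noncomputable def R22 (f k l m : ℝ × ℝ → ℝ) (x : ℝ × ℝ) : ℝ :=
  -((PiF f k l x * Real.exp (-(m x)) / 2) *
    (pd1 (fun y => pd1 l y / PiF f k l y) x + pd3 (fun y => pd3 l y / PiF f k l y) x
      + l x * SigF f k l x / (PiF f k l x) ^ 3))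

/-- Ricci component R₁₁ of the Lewis metric. -/
noncomputable def R11 (f k l m : ℝ × ℝ → ℝ) (x : ℝ × ℝ) : ℝ :=
  (1 / 2) * (-(pd1 (pd1 m) x) - pd3 (pd3 m) x - 2 * pd1 (pd1 (PiF f k l)) x / PiF f k l x
    + (1 / PiF f k l x) * (pd1 m x * pd1 (PiF f k l) x - pd3 m x * pd3 (PiF f k l) x)
    + (1 / (PiF f k l x) ^ 2) * (pd1 f x * pd1 l x + (pd1 k x) ^ 2))

/-- Ricci component R₃₃ of the Lewis metric. -/
noncomputable def R33 (f k l m : ℝ × ℝ → ℝ) (x : ℝ × ℝ) : ℝ :=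
  (1 / 2) * (-(pd1 (pd1 m) x) - pd3 (pd3 m) x - 2 * pd3 (pd3 (PiF f k l)) x / PiF f k l x
    - (1 / PiF f k l x) * (pd1 m x * pd1 (PiF f k l) x - pd3 m x * pd3 (PiF f k l) x)
    + (1 / (PiF f k l x) ^ 2) * (pd3 f x * pd3 l x + (pd3 k x) ^ 2))

/-- Ricci component R₁₃ of the Lewis metric. -/
noncomputable def R13 (f k l m : ℝ × ℝ → ℝ) (x : ℝ × ℝ) : ℝ :=
  (1 / 2) * (-(2 * pd1 (pd3 (PiF f k l)) x / PiF f k l x)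
    + (1 / PiF f k l x) * (pd3 m x * pd1 (PiF f k l) x + pd1 m x * pd3 (PiF f k l) x)
    + (1 / (2 * (PiF f k l x) ^ 2)) *
        (pd1 f x * pd3 l x + pd1 l x * pd3 f x + 2 * pd1 k x * pd3 k x))

/-- 𝔗₀₀ component of T_{μν} − ½ g_{μν} T. -/
noncomputable def T00 (Ω c : ℝ) (f k l ρ P : ℝ × ℝ → ℝ) (x : ℝ × ℝ) : ℝ :=
  (1 / 2) * (c ^ 2 * ρ x + P x) * (1 / fP Ω c f k l x) *
    ((f x - (Ω / c) * k x) ^ 2 + (Ω ^ 2 / c ^ 2) * (PiF f k l x) ^ 2) + P x * f x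

/-- 𝔗₀₂ component of T_{μν} − ½ g_{μν} T. -/
noncomputable def T02 (Ω c : ℝ) (f k l ρ P : ℝ × ℝ → ℝ) (x : ℝ × ℝ) : ℝ :=
  (1 / 2) * (c ^ 2 * ρ x + P x) * (1 / fP Ω c f k l x) *
    (-(k x * f x) - 2 * (Ω / c) * f x * l x + (Ω ^ 2 / c ^ 2) * k x * l x) - P x * k x

/-- 𝔗₂₂ component of T_{μν} − ½ g_{μν} T. -/
noncomputable def T22 (Ω c : ℝ) (f k l ρ P : ℝ × ℝ → ℝ) (x : ℝ × ℝ) : ℝ :=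
  (1 / 2) * (c ^ 2 * ρ x + P x) * (1 / fP Ω c f k l x) *
    ((PiF f k l x) ^ 2 + (k x + (Ω / c) * l x) ^ 2) - P x * l x

/-- Equation (EAa) at a point. -/
noncomputable def EAa (Ω c G : ℝ) (f k l m ρ P : ℝ × ℝ → ℝ) (x : ℝ × ℝ) : Prop :=
  pd1 (pd1 (FP Ω c f k l)) x + pd3 (pd3 (FP Ω c f k l)) x
    + (1 / PiF f k l x) * (pd1 (FP Ω c f k l) x * pd1 (PiF f k l) x
        + pd3 (FP Ω c f k l) x * pd3 (PiF f k l) x)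
    + (Real.exp (4 * FP Ω c f k l x) / (2 * (PiF f k l x) ^ 2)) *
        ((pd1 (AP Ω c f k l) x) ^ 2 + (pd3 (AP Ω c f k l) x) ^ 2)
    = (4 * π * G / c ^ 4) * Real.exp (-2 * FP Ω c f k l x + 2 * KP Ω c f k l m x) *
        (c ^ 2 * ρ x + 3 * P x)

/-- Equation (EAb) at a point. -/
noncomputable def EAb (Ω c : ℝ) (f k l : ℝ × ℝ → ℝ) (x : ℝ × ℝ) : Prop :=
  pd1 (fun y => (Real.exp (4 * FP Ω c f k l y) / PiF f k l y) * pd1 (AP Ω c f k l) y) x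
    + pd3 (fun y => (Real.exp (4 * FP Ω c f k l y) / PiF f k l y) * pd3 (AP Ω c f k l) y) x
    = 0

/-- Equation (EAc) at a point. -/
noncomputable def EAc (Ω c G : ℝ) (f k l m P : ℝ × ℝ → ℝ) (x : ℝ × ℝ) : Prop :=
  pd1 (pd1 (PiF f k l)) x + pd3 (pd3 (PiF f k l)) x
    = (16 * π * G / c ^ 4) * Real.exp (-2 * FP Ω c f k l x + 2 * KP Ω c f k l m x) *
        P x * PiF f k l x

/-- Equation (ECd) at a point. -/
noncomputable def ECd (Ω c : ℝ) (f k l m : ℝ × ℝ → ℝ) (x : ℝ × ℝ) : Prop :=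
  pd1 (PiF f k l) x * pd1 (KP Ω c f k l m) x - pd3 (PiF f k l) x * pd3 (KP Ω c f k l m) x
    = (1 / 2) * (pd1 (pd1 (PiF f k l)) x - pd3 (pd3 (PiF f k l)) x)
      + PiF f k l x * ((pd1 (FP Ω c f k l) x) ^ 2 - (pd3 (FP Ω c f k l) x) ^ 2)
      - (Real.exp (4 * FP Ω c f k l x) / (4 * PiF f k l x)) *
          ((pd1 (AP Ω c f k l) x) ^ 2 - (pd3 (AP Ω c f k l) x) ^ 2)

/-- Equation (ECe) at a point. -/
noncomputable def ECe (Ω c : ℝ) (f k l m : ℝ × ℝ → ℝ) (x : ℝ × ℝ) : Prop :=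
  pd3 (PiF f k l) x * pd1 (KP Ω c f k l m) x + pd1 (PiF f k l) x * pd3 (KP Ω c f k l m) x
    = pd1 (pd3 (PiF f k l)) x + 2 * PiF f k l x * pd1 (FP Ω c f k l) x * pd3 (FP Ω c f k l) x
      - (Real.exp (4 * FP Ω c f k l x) / (2 * PiF f k l x)) *
          pd1 (AP Ω c f k l) x * pd3 (AP Ω c f k l) x

section GradientIdentity

variable {E : Type*} [NormedAddCommGroup E] [NormedSpace ℝ E] {p q l Q : E → ℝ} {x : E}

/-- A directional derivative of `√Q` times `√Q` is half the directional derivative of `Q`. -/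
theorem sqrt_mul_fderiv_sqrt (hQ : DifferentiableAt ℝ Q x) (hpos : 0 < Q x) (v : E) :
    √(Q x) * fderiv ℝ (fun y => √(Q y)) x v = fderiv ℝ Q x v / 2 := by
  have h : √(Q x) ≠ 0 := (Real.sqrt_pos.2 hpos).ne'
  rw [(hQ.hasFDerivAt.sqrt hpos.ne').fderiv]
  simp only [smul_apply, smul_eq_mul]
  field_simp

/-- The quadratic form `dp · dl + dq²` in terms of `½ log p`, `√(p l + q²)` and `-q / p`. -/
theorem fderiv_mul_add_sq_eq (hp : DifferentiableAt ℝ p x) (hq : DifferentiableAt ℝ q x)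
    (hl : DifferentiableAt ℝ l x) (hp0 : 0 < p x) (hpos : 0 < p x * l x + q x ^ 2) (v : E) :
    fderiv ℝ p x v * fderiv ℝ l x v + fderiv ℝ q x v ^ 2
      = -4 * fderiv ℝ (fun y => 1 / 2 * Real.log (p y)) x v ^ 2 * √(p x * l x + q x ^ 2) ^ 2
        + 4 * fderiv ℝ (fun y => 1 / 2 * Real.log (p y)) x v * √(p x * l x + q x ^ 2)
          * fderiv ℝ (fun y => √(p y * l y + q y ^ 2)) x v
        + Real.exp (4 * (1 / 2 * Real.log (p x))) * fderiv ℝ (fun y => -q y / p y) x v ^ 2 := by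
  have hne := hp0.ne'
  have hF : fderiv ℝ (fun y => 1 / 2 * Real.log (p y)) x v = fderiv ℝ p x v / (2 * p x) := by
    rw [((hp.hasFDerivAt.log hne).const_mul (1 / 2)).fderiv]
    simp only [smul_apply, smul_eq_mul]
    field_simp
  have hA : fderiv ℝ (fun y => -q y / p y) x v
      = (q x * fderiv ℝ p x v - p x * fderiv ℝ q x v) / p x ^ 2 := by
    have h : HasFDerivAt (fun y => -q y / p y) _ x :=
      hq.hasFDerivAt.fun_neg.fun_mul ((hasDerivAt_inv hne).comp_hasFDerivAt x hp.hasFDerivAt)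
    rw [h.fderiv]
    simp only [add_apply, smul_apply, neg_apply, smul_eq_mul]
    field_simp
    ring
  have hQ := (hp.hasFDerivAt.fun_mul hl.hasFDerivAt).fun_add (hq.hasFDerivAt.pow 2)
  have hS := sqrt_mul_fderiv_sqrt hQ.differentiableAt hpos v
  rw [hQ.fderiv] at hS
  simp only [smul_apply, add_apply, smul_eq_mul] at hS
  have hexp : Real.exp (4 * (1 / 2 * Real.log (p x))) = p x ^ 2 := by
    rw [show 4 * (1 / 2 * Real.log (p x)) = Real.log (p x) + Real.log (p x) by ring, Real.exp_add,
      Real.exp_log hp0, sq]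
  rw [mul_assoc (4 * _) (√ _), hS, Real.sq_sqrt hpos.le, hF, hA, hexp]
  field_simp
  norm_num
  ring

end GradientIdentity

/-- Passing to rotating coordinates preserves `f l + k²`. -/
theorem fP_mul_add_kP_sq (Ω c : ℝ) (f k l : ℝ × ℝ → ℝ) (x : ℝ × ℝ) :
    fP Ω c f k l x * l x + kP Ω c k l x ^ 2 = f x * l x + k x ^ 2 := by
  simp only [fP, kP]
  ring

theorem hasFDerivAt_fP (Ω c : ℝ) {f k l : ℝ × ℝ → ℝ} {x : ℝ × ℝ} (hf : DifferentiableAt ℝ f x)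
    (hk : DifferentiableAt ℝ k x) (hl : DifferentiableAt ℝ l x) :
    HasFDerivAt (fP Ω c f k l)
      (fderiv ℝ f x - (2 * (Ω / c)) • fderiv ℝ k x - (Ω ^ 2 / c ^ 2) • fderiv ℝ l x) x :=
  (hf.hasFDerivAt.fun_sub (hk.hasFDerivAt.const_mul _)).fun_sub (hl.hasFDerivAt.const_mul _)

theorem hasFDerivAt_kP (Ω c : ℝ) {k l : ℝ × ℝ → ℝ} {x : ℝ × ℝ} (hk : DifferentiableAt ℝ k x)
    (hl : DifferentiableAt ℝ l x) :
    HasFDerivAt (kP Ω c k l) (fderiv ℝ k x + (Ω / c) • fderiv ℝ l x) x :=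
  hk.hasFDerivAt.fun_add (hl.hasFDerivAt.const_mul _)

/-- Passing to rotating coordinates preserves the quadratic form `df · dl + dk²`. -/
theorem fderiv_fP_mul_add_kP_sq (Ω c : ℝ) {f k l : ℝ × ℝ → ℝ} {x : ℝ × ℝ}
    (hf : DifferentiableAt ℝ f x) (hk : DifferentiableAt ℝ k x) (hl : DifferentiableAt ℝ l x)
    (v : ℝ × ℝ) :
    fderiv ℝ (fP Ω c f k l) x v * fderiv ℝ l x v + fderiv ℝ (kP Ω c k l) x v ^ 2
      = fderiv ℝ f x v * fderiv ℝ l x v + fderiv ℝ k x v ^ 2 := by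
  rw [(hasFDerivAt_fP Ω c hf hk hl).fderiv, (hasFDerivAt_kP Ω c hk hl).fderiv]
  simp only [smul_apply, add_apply, sub_apply, smul_eq_mul]
  ring

/-- The quadratic form `df' · dl + dk'²` in terms of `F'`, `Π` and `A'`. -/
theorem fderiv_fP_mul_add_kP_sq_eq (Ω c : ℝ) {f k l : ℝ × ℝ → ℝ} {x : ℝ × ℝ}
    (hf : DifferentiableAt ℝ f x) (hk : DifferentiableAt ℝ k x) (hl : DifferentiableAt ℝ l x)
    (hpos : 0 < f x * l x + k x ^ 2) (hfP : 0 < fP Ω c f k l x) (v : ℝ × ℝ) :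
    fderiv ℝ (fP Ω c f k l) x v * fderiv ℝ l x v + fderiv ℝ (kP Ω c k l) x v ^ 2
      = -4 * fderiv ℝ (FP Ω c f k l) x v ^ 2 * PiF f k l x ^ 2
        + 4 * fderiv ℝ (FP Ω c f k l) x v * PiF f k l x * fderiv ℝ (PiF f k l) x v
        + Real.exp (4 * FP Ω c f k l x) * fderiv ℝ (AP Ω c f k l) x v ^ 2 := by
  have hPi : PiF f k l = fun y => √(fP Ω c f k l y * l y + kP Ω c k l y ^ 2) := by
    funext y
    rw [fP_mul_add_kP_sq, PiF]
  rw [hPi]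
  exact fderiv_mul_add_sq_eq (hasFDerivAt_fP Ω c hf hk hl).differentiableAt
    (hasFDerivAt_kP Ω c hk hl).differentiableAt hl hfP
    (by rwa [fP_mul_add_kP_sq]) v

/-- Identity (54): for j = 1, 3,
∂_jf·∂_jl + (∂_jk)² = ∂_jf'·∂_jl' + (∂_jk')²
  = −4(∂_jF')²Π² + 4∂_jF'·Π·∂_jΠ + e^{4F'}(∂_jA')². -/
theorem gradient_identity_54
    (D : Set (ℝ × ℝ)) (hD : IsOpen D)
    (Ω c : ℝ) (hc : 0 < c)
    (f k l : ℝ × ℝ → ℝ)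
    (hf : ContDiffOn ℝ (⊤ : ℕ∞) f D) (hk : ContDiffOn ℝ (⊤ : ℕ∞) k D) (hl : ContDiffOn ℝ (⊤ : ℕ∞) l D)
    (hpos : ∀ x ∈ D, 0 < f x * l x + (k x) ^ 2)
    (hfP : ∀ x ∈ D, 0 < fP Ω c f k l x) :
    ∀ x ∈ D,
      (pd1 f x * pd1 l x + (pd1 k x) ^ 2
          = pd1 (fP Ω c f k l) x * pd1 l x + (pd1 (kP Ω c k l) x) ^ 2
        ∧ pd1 (fP Ω c f k l) x * pd1 l x + (pd1 (kP Ω c k l) x) ^ 2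
          = -4 * (pd1 (FP Ω c f k l) x) ^ 2 * (PiF f k l x) ^ 2
            + 4 * pd1 (FP Ω c f k l) x * PiF f k l x * pd1 (PiF f k l) x
            + Real.exp (4 * FP Ω c f k l x) * (pd1 (AP Ω c f k l) x) ^ 2)
      ∧ (pd3 f x * pd3 l x + (pd3 k x) ^ 2
          = pd3 (fP Ω c f k l) x * pd3 l x + (pd3 (kP Ω c k l) x) ^ 2
        ∧ pd3 (fP Ω c f k l) x * pd3 l x + (pd3 (kP Ω c k l) x) ^ 2
          = -4 * (pd3 (FP Ω c f k l) x) ^ 2 * (PiF f k l x) ^ 2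
            + 4 * pd3 (FP Ω c f k l) x * PiF f k l x * pd3 (PiF f k l) x
            + Real.exp (4 * FP Ω c f k l x) * (pd3 (AP Ω c f k l) x) ^ 2) := by
  intro x hx
  have hD' := hD.mem_nhds hx
  have hf' := (hf.contDiffAt hD').differentiableAt (by simp)
  have hk' := (hk.contDiffAt hD').differentiableAt (by simp)
  have hl' := (hl.contDiffAt hD').differentiableAt (by simp)
  have transform := fun v => (fderiv_fP_mul_add_kP_sq Ω c hf' hk' hl' v).symm
  have expand := fderiv_fP_mul_add_kP_sq_eq Ω c hf' hk' hl' (hpos x hx) (hfP x hx)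
  exact ⟨⟨transform (1, 0), expand (1, 0)⟩, ⟨transform (0, 1), expand (0, 1)⟩⟩
end

section
/- Assume the kernel condition: the only continuous h : B̄ → ℝ with h = 𝒦[(1/(γ−1))·(Θ ∨ 0)^q · h] is h = 0. Then for every α-Hölder continuous g : B̄ → ℝ there exists a unique continuous W : B̄ → ℝ satisfying W = 𝒦[(1/(γ−1))·(Θ ∨ 0)^q · W + g]. This W satisfies W(0) = 0, is twice continuously differentiable on the open ball {|ξ| < Ξ}, solves ΔW + (1/(γ−1))·(Θ ∨ 0)^q·W + g = 0 there, and there is a constant C independent of g such that sup_{B̄}|W| ≤ C·sup_{B̄}|g|. -/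
open Real MeasureTheory

/-- The cut-off Newtonian potential of dimension 3:
(𝒦⁽³⁾h)(ξ) = (1/(4π)) ∫ h(ξ')·χ(|ξ'|)·|ξ − ξ'|⁻¹ dξ'. -/
noncomputable def newton3 (χ : ℝ → ℝ) (h : EuclideanSpace ℝ (Fin 3) → ℝ)
    (ξ : EuclideanSpace ℝ (Fin 3)) : ℝ :=
  (1 / (4 * Real.pi)) * ∫ ξ' : EuclideanSpace ℝ (Fin 3), h ξ' * χ ‖ξ'‖ / ‖ξ - ξ'‖

/-- 𝒦h := 𝒦⁽³⁾h − (𝒦⁽³⁾h)(0). -/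
noncomputable def newton3' (χ : ℝ → ℝ) (h : EuclideanSpace ℝ (Fin 3) → ℝ)
    (ξ : EuclideanSpace ℝ (Fin 3)) : ℝ :=
  newton3 χ h ξ - newton3 χ h 0

/-- The Laplacian Δf(ξ) = Σⱼ ∂²f/∂ξⱼ². -/
noncomputable def laplacian3 (f : EuclideanSpace ℝ (Fin 3) → ℝ)
    (ξ : EuclideanSpace ℝ (Fin 3)) : ℝ :=
  ∑ j : Fin 3,
    fderiv ℝ (fun y => fderiv ℝ f y (EuclideanSpace.single j 1)) ξ
      (EuclideanSpace.single j 1)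

namespace NewtonPotential

open Set Filter Topology Metric

section DyadicSums

variable {E : Type*} [NormedAddCommGroup E] [NormedSpace ℝ E]

section Dilation

lemma hasCompactSupport_comp_smul {F : Type*} [Zero F] {ψ : E → F}
    (hψ : HasCompactSupport ψ) {r : ℝ} (hr : r ≠ 0) : HasCompactSupport fun z => ψ (r • z) :=
  hψ.comp_homeomorph (Homeomorph.smulOfNeZero r hr)

lemma hasCompactSupport_dilation {F : Type*} [Zero F] {ψ : E → F}
    (hψ : HasCompactSupport ψ) {r : ℝ} (hr : r ≠ 0) (x : E) :
    HasCompactSupport fun t => ψ (r • (x - t)) :=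
  (hasCompactSupport_comp_smul hψ hr).comp_homeomorph (Homeomorph.subLeft x)

lemma integrable_dilation {F : Type*} [NormedAddCommGroup F] [MeasureSpace E] [BorelSpace E]
    [IsFiniteMeasureOnCompacts (volume : Measure E)] {ψ : E → F} (hψ : HasCompactSupport ψ)
    (hψc : Continuous ψ) {r : ℝ} (hr : r ≠ 0) (x : E) : Integrable fun t => ψ (r • (x - t)) :=
  Continuous.integrable_of_hasCompactSupport (by fun_prop) (hasCompactSupport_dilation hψ hr x)

variable {F : Type*} [NormedAddCommGroup F] [NormedSpace ℝ F]

/-- The convolution of `f` with the dilation `z ↦ ψ (r • z)`. -/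
noncomputable def dilConv [MeasureSpace E] (f : E → ℝ) (ψ : E → F) (r : ℝ) (x : E) : F :=
  ∫ t, f t • ψ (r • (x - t))

variable [MeasureSpace E] [BorelSpace E] [(volume : Measure E).IsAddHaarMeasure]

lemma integrable_dilConv_integrand {f : E → ℝ} (hf : Continuous f) {ψ : E → F}
    (hψ : HasCompactSupport ψ) (hψc : Continuous ψ) {r : ℝ} (hr : r ≠ 0) (x : E) :
    Integrable fun t => f t • ψ (r • (x - t)) :=
  Continuous.integrable_of_hasCompactSupport (by fun_prop)
    (hasCompactSupport_dilation hψ hr x).smul_left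

lemma clm_dilConv [CompleteSpace F] (L : F →L[ℝ] ℝ) {f : E → ℝ} {ψ : E → F} {r : ℝ}
    (hf : Continuous f)
    (hψs : HasCompactSupport ψ) (hψ : Continuous ψ) (hr : r ≠ 0) (x : E) :
    L (dilConv f ψ r x) = dilConv f (fun z => L (ψ z)) r x := by
  rw [dilConv, dilConv, ← L.integral_comp_comm (integrable_dilConv_integrand hf hψs hψ hr x)]
  exact integral_congr_ae (.of_forall fun t => L.map_smul _ _)

variable [FiniteDimensional ℝ E]

lemma hasFDerivAt_dilConv {f : E → ℝ} (hf : LocallyIntegrable f) {ψ : E → F}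
    (hψ : HasCompactSupport ψ) (hψ1 : ContDiff ℝ 1 ψ) {r : ℝ} (hr : r ≠ 0) (x : E) :
    HasFDerivAt (dilConv f ψ r) (r • dilConv f (fderiv ℝ ψ) r x) x := by
  have h := (hasCompactSupport_comp_smul hψ hr).hasFDerivAt_convolution_right
    (ContinuousLinearMap.lsmul ℝ ℝ) (μ := volume) hf (hψ1.comp (contDiff_const_smul r)) x
  have e : r • dilConv f (fderiv ℝ ψ) r x =
      convolution f (fderiv ℝ (fun z => ψ (r • z)))
        (ContinuousLinearMap.precompR E (ContinuousLinearMap.lsmul ℝ ℝ)) volume x := by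
    rw [dilConv, ← integral_smul, convolution_def]
    refine integral_congr_ae (.of_forall fun t => ?_)
    ext v
    beta_reduce
    rw [fderiv_comp_smul, ContinuousLinearMap.precompR_apply]
    exact smul_comm r (f t) _
  rw [e]
  exact h

lemma integral_dilation (hd : Module.finrank ℝ E = 3) (ψ : E → F) {r : ℝ} (hr : 0 < r) (x : E) :
    ∫ t, ψ (r • (x - t)) = (r ^ 3)⁻¹ • ∫ z, ψ z := by
  rw [integral_sub_left_eq_self (fun z => ψ (r • z)) volume x,
    Measure.integral_comp_smul_of_nonneg volume ψ r (hR := hr.le), hd]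

lemma norm_dilConv_le (hd : Module.finrank ℝ E = 3) {f : E → ℝ} {M : ℝ} (hfM : ∀ x, |f x| ≤ M)
    {ψ : E → F} (hψ : HasCompactSupport ψ) (hψc : Continuous ψ)
    {r : ℝ} (hr : 0 < r) (x : E) :
    ‖dilConv f ψ r x‖ ≤ M * (r ^ 3)⁻¹ * ∫ z, ‖ψ z‖ := by
  have := integral_dilation hd (fun z => ‖ψ z‖) hr x
  rw [smul_eq_mul] at this
  rw [mul_assoc, ← this, ← integral_const_mul]
  refine norm_integral_le_of_norm_le ((integrable_dilation hψ hψc hr.ne' x).norm.const_mul M)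
    (.of_forall fun t => ?_)
  rw [norm_smul]
  exact mul_le_mul_of_nonneg_right (hfM t) (norm_nonneg _)

/-- Hölder cancellation: replacing `f` by the constant `f x` costs only a power of the scale. -/
lemma norm_dilConv_sub_le (hd : Module.finrank ℝ E = 3) {f : E → ℝ} (hf : Continuous f)
    {H α : ℝ} (hα : 0 ≤ α) (hH : 0 ≤ H)
    (hfH : ∀ x y, |f x - f y| ≤ H * ‖x - y‖ ^ α)
    {ψ : E → F} (hψs : ∀ z, 1 < ‖z‖ → ψ z = 0) (hψ : HasCompactSupport ψ) (hψc : Continuous ψ)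
    {r : ℝ} (hr : 0 < r) (x : E) :
    ‖dilConv f ψ r x - f x • (r ^ 3)⁻¹ • ∫ z, ψ z‖ ≤ H * r⁻¹ ^ α * (r ^ 3)⁻¹ * ∫ z, ‖ψ z‖ := by
  have h := integral_dilation hd (fun z => ‖ψ z‖) hr x
  rw [smul_eq_mul] at h
  rw [mul_assoc, ← h, ← integral_const_mul, ← integral_dilation hd ψ hr x, dilConv, ← integral_smul,
    ← integral_sub (integrable_dilConv_integrand hf hψ hψc hr.ne' x)
      (show Integrable fun t => f x • ψ (r • (x - t)) from
        (integrable_dilation hψ hψc hr.ne' x).smul (f x))]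
  refine norm_integral_le_of_norm_le
    ((integrable_dilation hψ hψc hr.ne' x).norm.const_mul (H * r⁻¹ ^ α))
    (.of_forall fun t => ?_)
  rw [← sub_smul, norm_smul, Real.norm_eq_abs]
  rcases lt_or_ge 1 ‖r • (x - t)‖ with h1 | h1
  · simp [hψs _ h1]
  · refine mul_le_mul_of_nonneg_right ((hfH t x).trans ?_) (norm_nonneg _)
    rw [norm_smul, Real.norm_of_nonneg hr.le] at h1
    gcongr
    rw [norm_sub_rev, ← one_div, le_div_iff₀ hr, mul_comm]
    exact h1

lemma integral_fderiv_eq_zero (hd : Module.finrank ℝ E = 3) [CompleteSpace F]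
    {ψ : E → F} (hψ : HasCompactSupport ψ)
    (hψ1 : ContDiff ℝ 1 ψ) : ∫ z, fderiv ℝ ψ z = 0 := by
  have h := hasFDerivAt_dilConv (f := fun _ => 1) continuous_const.locallyIntegrable hψ hψ1
    one_ne_zero 0
  have hc : dilConv (fun _ => 1) ψ 1 = fun _ => ∫ z, ψ z := by
    ext x
    simpa [dilConv] using! integral_dilation hd ψ one_pos x
  have h2 := integral_dilation hd (fderiv ℝ ψ) one_pos 0
  rw [hc] at h
  have h3 := h.unique (hasFDerivAt_const _ _)
  simp only [dilConv, one_smul] at h3 h2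
  rw [h3] at h2
  simpa using! h2.symm

end Dilation

section DyadicSum

variable [FiniteDimensional ℝ E] [MeasureSpace E] [BorelSpace E]
  [(volume : Measure E).IsAddHaarMeasure]
variable {f : E → ℝ} {M H α r : ℝ} {φ : E → ℝ}

lemma summable_dyadic_inv_rpow (hr : 0 < r) (hα : 0 < α) :
    Summable fun n : ℕ => ((2 ^ n * r)⁻¹) ^ α := by
  have h : (fun n : ℕ => ((2 ^ n * r)⁻¹) ^ α) = fun n : ℕ => ((2⁻¹ : ℝ) ^ α) ^ n * r⁻¹ ^ α := by
    ext n
    rw [mul_inv, ← inv_pow, Real.mul_rpow (by positivity) (by positivity),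
      ← Real.rpow_natCast, ← Real.rpow_natCast, ← Real.rpow_mul (by positivity),
      ← Real.rpow_mul (by positivity), mul_comm α]
  rw [h]
  exact (summable_geometric_of_lt_one (by positivity)
    (Real.rpow_lt_one (by norm_num) (by norm_num) hα)).mul_right _

/-- The dyadic sum of rescaled convolutions. -/
noncomputable def dyadicSum {E F : Type*} [NormedAddCommGroup E] [NormedSpace ℝ E]
    [MeasureSpace E] [NormedAddCommGroup F] [NormedSpace ℝ F] (k : ℕ) (f : E → ℝ) (ψ : E → F)
    (r : ℝ) (x : E) : F :=
  ∑' n : ℕ, (2 ^ n * r) ^ k • dilConv f ψ (2 ^ n * r) x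

lemma hasFDerivAt_pow_smul_dilConv {F : Type*} [NormedAddCommGroup F] [NormedSpace ℝ F]
    (hf : Continuous f) {ψ : E → F} (hψ : HasCompactSupport ψ) (hψ1 : ContDiff ℝ 1 ψ)
    (hr : 0 < r) (k : ℕ) (x : E) :
    HasFDerivAt (fun x => r ^ k • dilConv f ψ r x)
      (r ^ (k + 1) • dilConv f (fderiv ℝ ψ) r x) x := by
  have := (hasFDerivAt_dilConv hf.locallyIntegrable hψ hψ1 hr.ne' x).const_smul (r ^ k)
  rwa [smul_smul, ← pow_succ] at this

lemma summable_dyadicSum {F : Type*} [NormedAddCommGroup F] [NormedSpace ℝ F] [CompleteSpace F]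
    {φ : E → F} (hd : Module.finrank ℝ E = 3) (hr : 0 < r) (hfM : ∀ x, |f x| ≤ M)
    (hφs : HasCompactSupport φ)
    (hφ : Continuous φ) (x : E) :
    Summable fun n : ℕ => (2 ^ n * r) ^ 1 • dilConv f φ (2 ^ n * r) x := by
  refine .of_norm_bounded (g := fun n : ℕ => (M * ∫ z, ‖φ z‖) * ((2 ^ n * r)⁻¹) ^ (2 : ℝ))
    ((summable_dyadic_inv_rpow hr two_pos).mul_left _) fun n => ?_
  have hn : 0 < 2 ^ n * r := by positivity
  generalize 2 ^ n * r = s at hn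
  rw [pow_one, norm_smul, Real.norm_of_nonneg hn.le]
  refine (mul_le_mul_of_nonneg_left (norm_dilConv_le hd hfM hφs hφ hn x) hn.le).trans_eq ?_
  rw [Real.rpow_two]
  field_simp

lemma norm_sq_smul_dilConv_le {F : Type*} [NormedAddCommGroup F] [NormedSpace ℝ F]
    (hd : Module.finrank ℝ E = 3) (hfM : ∀ x, |f x| ≤ M) {ψ : E → F}
    (hψs : HasCompactSupport ψ) (hψ : Continuous ψ) (hr : 0 < r) (x : E) :
    ‖r ^ 2 • dilConv f ψ r x‖ ≤ (M * ∫ z, ‖ψ z‖) * r⁻¹ ^ (1 : ℝ) := by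
  rw [norm_smul, norm_pow, Real.norm_of_nonneg hr.le]
  refine (mul_le_mul_of_nonneg_left (norm_dilConv_le hd hfM hψs hψ hr x)
    (by positivity)).trans_eq ?_
  rw [Real.rpow_one]
  field_simp

section Generic

variable {F : Type*} [NormedAddCommGroup F] [NormedSpace ℝ F] {ψ : E → F}

lemma norm_sq_smul_dilConv_fderiv_le (hd : Module.finrank ℝ E = 3) (hfM : ∀ x, |f x| ≤ M)
    (hψs : HasCompactSupport ψ) (hψ : ContDiff ℝ 1 ψ) (hr : 0 < r) (x : E) :
    ‖r ^ 2 • dilConv f (fderiv ℝ ψ) r x‖ ≤ (M * ∫ z, ‖fderiv ℝ ψ z‖) * r⁻¹ ^ (1 : ℝ) := by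
  have h := norm_dilConv_le hd hfM (hψs.fderiv ℝ) (hψ.continuous_fderiv one_ne_zero) hr x
  rw [norm_smul, norm_pow, Real.norm_of_nonneg hr.le]
  refine (mul_le_mul_of_nonneg_left h (by positivity)).trans_eq ?_
  rw [Real.rpow_one]
  field_simp

variable [CompleteSpace F]

lemma norm_dilConv_fderiv_le_of_holder (hd : Module.finrank ℝ E = 3) (hf : Continuous f)
    (hα : 0 < α) (hH : 0 ≤ H) (hfH : ∀ x y, |f x - f y| ≤ H * ‖x - y‖ ^ α)
    (hψ1 : tsupport ψ ⊆ closedBall 0 1) (hψ : ContDiff ℝ 1 ψ) (hr : 0 < r) (x : E) :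
    ‖r ^ 3 • dilConv f (fderiv ℝ ψ) r x‖ ≤ (H * ∫ z, ‖fderiv ℝ ψ z‖) * r⁻¹ ^ α := by
  have hψs : HasCompactSupport ψ :=
    (isCompact_closedBall 0 1).of_isClosed_subset (isClosed_tsupport ψ) hψ1
  have h0 : ∀ z, 1 < ‖z‖ → fderiv ℝ ψ z = 0 := by
    intro z hz
    refine image_eq_zero_of_notMem_tsupport fun h => ?_
    exact hz.not_ge (by simpa using hψ1 (tsupport_fderiv_subset ℝ h))
  have h := norm_dilConv_sub_le hd hf hα.le hH hfH h0 (hψs.fderiv ℝ)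
    (hψ.continuous_fderiv one_ne_zero) hr x
  rw [integral_fderiv_eq_zero hd hψs hψ, smul_zero, smul_zero, sub_zero] at h
  rw [norm_smul, norm_pow, Real.norm_of_nonneg hr.le]
  refine (mul_le_mul_of_nonneg_left h (by positivity)).trans_eq ?_
  field_simp

lemma summable_dilConv_fderiv_of_holder (hd : Module.finrank ℝ E = 3) (hf : Continuous f)
    (hα : 0 < α) (hH : 0 ≤ H) (hfH : ∀ x y, |f x - f y| ≤ H * ‖x - y‖ ^ α)
    (hψ1 : tsupport ψ ⊆ closedBall 0 1) (hψ : ContDiff ℝ 1 ψ) (hr : 0 < r) (x : E) :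
    Summable fun n : ℕ => (2 ^ n * r) ^ 3 • dilConv f (fderiv ℝ ψ) (2 ^ n * r) x :=
  .of_norm_bounded ((summable_dyadic_inv_rpow hr hα).mul_left _) fun n =>
    norm_dilConv_fderiv_le_of_holder hd hf hα hH hfH hψ1 hψ (r := 2 ^ n * r) (by positivity) x

lemma hasFDerivAt_tsum_dilConv (hd : Module.finrank ℝ E = 3) (hf : Continuous f)
    (hfM : ∀ x, |f x| ≤ M)
    (hα : 0 < α) (hH : 0 ≤ H) (hfH : ∀ x y, |f x - f y| ≤ H * ‖x - y‖ ^ α)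
    (hψ1 : tsupport ψ ⊆ closedBall 0 1) (hψ : ContDiff ℝ 1 ψ) (hr : 0 < r) (x : E) :
    HasFDerivAt (dyadicSum 2 f ψ r) (dyadicSum 3 f (fderiv ℝ ψ) r x) x := by
  have hψs : HasCompactSupport ψ :=
    (isCompact_closedBall 0 1).of_isClosed_subset (isClosed_tsupport ψ) hψ1
  refine hasFDerivAt_tsum ((summable_dyadic_inv_rpow hr hα).mul_left _) (fun n x => ?_)
    (fun n x => norm_dilConv_fderiv_le_of_holder hd hf hα hH hfH hψ1 hψ (r := 2 ^ n * r)
      (by positivity) x) (x₀ := 0) (.of_norm_bounded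
      ((summable_dyadic_inv_rpow hr one_pos).mul_left _)
      fun n => norm_sq_smul_dilConv_le hd hfM hψs hψ.continuous (r := 2 ^ n * r)
        (by positivity) 0) x
  exact hasFDerivAt_pow_smul_dilConv hf hψs hψ (r := 2 ^ n * r) (by positivity) 2 x

lemma continuous_tsum_dilConv_fderiv (hd : Module.finrank ℝ E = 3) (hf : Continuous f)
    (hα : 0 < α) (hH : 0 ≤ H) (hfH : ∀ x y, |f x - f y| ≤ H * ‖x - y‖ ^ α)
    (hψ1 : tsupport ψ ⊆ closedBall 0 1) (hψ : ContDiff ℝ 2 ψ) (hr : 0 < r) :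
    Continuous (dyadicSum 3 f (fderiv ℝ ψ) r) := by
  have hψs : HasCompactSupport ψ :=
    (isCompact_closedBall 0 1).of_isClosed_subset (isClosed_tsupport ψ) hψ1
  refine continuous_tsum (fun n => ?_) ((summable_dyadic_inv_rpow hr hα).mul_left _) (fun n x =>
    norm_dilConv_fderiv_le_of_holder hd hf hα hH hfH hψ1 (hψ.of_le (by norm_num))
      (r := 2 ^ n * r) (by positivity) x)
  refine continuous_iff_continuousAt.2 fun x => ?_
  exact (hasFDerivAt_pow_smul_dilConv hf (hψs.fderiv ℝ) (hψ.fderiv_right (by norm_num))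
    (r := 2 ^ n * r) (by positivity) 3 x).continuousAt

lemma hasFDerivAt_dyadicSum (hd : Module.finrank ℝ E = 3) (hf : Continuous f)
    (hfM : ∀ x, |f x| ≤ M) (hψs : HasCompactSupport ψ) (hψ : ContDiff ℝ 1 ψ) (hr : 0 < r)
    (x : E) :
    HasFDerivAt (dyadicSum 1 f ψ r) (dyadicSum 2 f (fderiv ℝ ψ) r x) x := by
  have h2 : ∀ n : ℕ, ∀ x, ‖(2 ^ n * r) ^ 2 • dilConv f (fderiv ℝ ψ) (2 ^ n * r) x‖ ≤
      (M * ∫ z, ‖fderiv ℝ ψ z‖) * (2 ^ n * r)⁻¹ ^ (1 : ℝ) := fun n x =>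
    norm_sq_smul_dilConv_fderiv_le hd hfM hψs hψ (by positivity) x
  have h1 : ∀ n : ℕ, ∀ x, HasFDerivAt (fun x => (2 ^ n * r) ^ 1 • dilConv f ψ (2 ^ n * r) x)
      ((2 ^ n * r) ^ 2 • dilConv f (fderiv ℝ ψ) (2 ^ n * r) x) x := fun n x =>
    hasFDerivAt_pow_smul_dilConv hf hψs hψ (by positivity) 1 x
  exact hasFDerivAt_tsum ((summable_dyadic_inv_rpow hr one_pos).mul_left _) h1 h2
    (summable_dyadicSum hd hr hfM hψs hψ.continuous 0) x

lemma hasFDerivAt_fderiv_dyadicSum (hd : Module.finrank ℝ E = 3) (hf : Continuous f)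
    (hfM : ∀ x, |f x| ≤ M) (hα : 0 < α)
    (hH : 0 ≤ H) (hfH : ∀ x y, |f x - f y| ≤ H * ‖x - y‖ ^ α)
    (hψ1 : tsupport ψ ⊆ closedBall 0 1) (hψ : ContDiff ℝ 3 ψ) (hr : 0 < r) (x : E) :
    HasFDerivAt (fderiv ℝ (dyadicSum 1 f ψ r))
      (dyadicSum 3 f (fderiv ℝ (fderiv ℝ ψ)) r x) x := by
  have hψs : HasCompactSupport ψ :=
    (isCompact_closedBall 0 1).of_isClosed_subset (isClosed_tsupport ψ) hψ1
  have h0 : fderiv ℝ (dyadicSum 1 f ψ r) = dyadicSum 2 f (fderiv ℝ ψ) r := funext fun x =>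
    (hasFDerivAt_dyadicSum hd hf hfM hψs (hψ.of_le (by norm_num)) hr x).fderiv
  have h1 : tsupport (fderiv ℝ ψ) ⊆ closedBall 0 1 := (tsupport_fderiv_subset ℝ).trans hψ1
  have h2 : ContDiff ℝ 1 (fderiv ℝ ψ) := hψ.fderiv_right (by norm_num)
  rw [h0]
  exact hasFDerivAt_tsum_dilConv hd hf hfM hα hH hfH h1 h2 hr x

lemma contDiff_dyadicSum (hd : Module.finrank ℝ E = 3) (hf : Continuous f)
    (hfM : ∀ x, |f x| ≤ M) (hα : 0 < α)
    (hH : 0 ≤ H) (hfH : ∀ x y, |f x - f y| ≤ H * ‖x - y‖ ^ α)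
    (hψ1 : tsupport ψ ⊆ closedBall 0 1) (hψ : ContDiff ℝ 3 ψ) (hr : 0 < r) :
    ContDiff ℝ 2 (dyadicSum 1 f ψ r) := by
  have hψs : HasCompactSupport ψ :=
    (isCompact_closedBall 0 1).of_isClosed_subset (isClosed_tsupport ψ) hψ1
  rw [show (2 : WithTop ℕ∞) = ((1 : ℕ) : WithTop ℕ∞) + 1 by norm_num,
    contDiff_succ_iff_hasFDerivAt]
  refine ⟨fderiv ℝ (dyadicSum 1 f ψ r), ?_, fun x =>
    (hasFDerivAt_dyadicSum hd hf hfM hψs (hψ.of_le (by norm_num)) hr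
      x).differentiableAt.hasFDerivAt⟩
  rw [Nat.cast_one, contDiff_one_iff_hasFDerivAt]
  exact ⟨_, continuous_tsum_dilConv_fderiv hd hf hα hH hfH
    ((tsupport_fderiv_subset ℝ).trans hψ1) (hψ.fderiv_right (by norm_num)) hr,
    hasFDerivAt_fderiv_dyadicSum hd hf hfM hα hH hfH hψ1 hψ hr⟩

lemma hasSum_clm_dyadicSum (L : (E →L[ℝ] F) →L[ℝ] ℝ) (hd : Module.finrank ℝ E = 3)
    (hf : Continuous f)
    (hα : 0 < α) (hH : 0 ≤ H) (hfH : ∀ x y, |f x - f y| ≤ H * ‖x - y‖ ^ α)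
    (hψ1 : tsupport ψ ⊆ closedBall 0 1) (hψ : ContDiff ℝ 1 ψ) (hr : 0 < r) (x : E) :
    HasSum (fun n : ℕ => (2 ^ n * r) ^ 3 • dilConv f (fun z => L (fderiv ℝ ψ z)) (2 ^ n * r) x)
      (L (dyadicSum 3 f (fderiv ℝ ψ) r x)) := by
  have hψs : HasCompactSupport ψ :=
    (isCompact_closedBall 0 1).of_isClosed_subset (isClosed_tsupport ψ) hψ1
  have hs := L.hasSum (summable_dilConv_fderiv_of_holder hd hf hα hH hfH hψ1 hψ hr x).hasSum
  refine hs.congr_fun fun n => ?_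
  rw [L.map_smul, clm_dilConv L hf (hψs.fderiv ℝ)
    (hψ.continuous_fderiv one_ne_zero) (by positivity)]

end Generic

end DyadicSum

end DyadicSums

section Profile

/-- A smooth function which vanishes on `(-∞, 1/4]` and equals `s ^ (-1/2)` on `[1, ∞)`. -/
noncomputable def profile (s : ℝ) : ℝ := smoothTransition ((4 * s - 1) / 3) * s ^ (-1 / 2 : ℝ)

lemma profile_of_le {s : ℝ} (hs : s ≤ 1 / 4) : profile s = 0 := by
  rw [profile, smoothTransition.zero_of_nonpos (by linarith), zero_mul]

lemma profile_of_one_le {s : ℝ} (hs : 1 ≤ s) : profile s = s ^ (-1 / 2 : ℝ) := by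
  rw [profile, smoothTransition.one_of_one_le (by linarith), one_mul]

lemma abs_profile_sq_le (s : ℝ) : |profile (s ^ 2)| ≤ |s|⁻¹ := by
  have h : (s ^ 2) ^ (-1 / 2 : ℝ) = |s|⁻¹ := by
    rw [← sq_abs, ← Real.rpow_natCast, ← Real.rpow_mul (abs_nonneg s), ← Real.rpow_neg_one]
    norm_num
  rw [profile, h, abs_mul, abs_of_nonneg (smoothTransition.nonneg _), abs_of_nonneg (by positivity)]
  exact mul_le_of_le_one_left (by positivity) (smoothTransition.le_one _)

lemma profile_sq_of_one_le {s : ℝ} (hs : 1 ≤ s) : profile (s ^ 2) = s⁻¹ := by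
  rw [profile_of_one_le (one_le_pow₀ hs), ← Real.rpow_natCast, ← Real.rpow_mul (by positivity),
    ← Real.rpow_neg_one]
  norm_num

lemma contDiff_profile {n : ℕ∞} : ContDiff ℝ n profile := by
  refine contDiff_iff_contDiffAt.2 fun s => ?_
  rcases lt_or_ge s (1 / 4) with hs | hs
  · have : profile =ᶠ[𝓝 s] fun _ => 0 := by
      filter_upwards [Iio_mem_nhds hs] with t ht using profile_of_le (le_of_lt ht)
    exact contDiffAt_const.congr_of_eventuallyEq this
  · refine ContDiffAt.mul ?_ (Real.contDiffAt_rpow_const_of_ne (by linarith))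
    exact (smoothTransition.contDiff.comp (by fun_prop)).contDiffAt

lemma hasDerivAt_profile (s : ℝ) : HasDerivAt profile (deriv profile s) s :=
  ((contDiff_profile (n := 1)).differentiable (by norm_num) s).hasDerivAt

lemma contDiff_deriv_profile {n : ℕ} : ContDiff ℝ n (deriv profile) := by
  have h : ContDiff ℝ ((n : WithTop ℕ∞) + 1) profile := by
    exact_mod_cast contDiff_profile (n := (n + 1 : ℕ))
  exact ((contDiff_succ_iff_deriv).1 h).2.2

lemma hasDerivAt_deriv_profile (s : ℝ) :
    HasDerivAt (deriv profile) (deriv (deriv profile) s) s :=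
  ((contDiff_deriv_profile (n := 1)).differentiable (by norm_num) s).hasDerivAt

lemma continuous_deriv_deriv_profile : Continuous (deriv (deriv profile)) :=
  (contDiff_deriv_profile (n := 1)).continuous_deriv (by norm_num)

lemma deriv_profile_of_lt {s : ℝ} (hs : s < 1 / 4) : deriv profile s = 0 := by
  have : profile =ᶠ[𝓝 s] fun _ => 0 := by
    filter_upwards [Iio_mem_nhds hs] with t ht using profile_of_le (le_of_lt ht)
  rw [this.deriv_eq, deriv_const]

lemma deriv_deriv_profile_of_lt {s : ℝ} (hs : s < 1 / 4) : deriv (deriv profile) s = 0 := by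
  have : deriv profile =ᶠ[𝓝 s] fun _ => 0 := by
    filter_upwards [Iio_mem_nhds hs] with t ht using deriv_profile_of_lt ht
  rw [this.deriv_eq, deriv_const]

lemma deriv_profile_of_one_lt {s : ℝ} (hs : 1 < s) :
    deriv profile s = -1 / 2 * s ^ (-3 / 2 : ℝ) := by
  have : profile =ᶠ[𝓝 s] fun t => t ^ (-1 / 2 : ℝ) := by
    filter_upwards [Ioi_mem_nhds hs] with t ht using profile_of_one_le (le_of_lt ht)
  rw [this.deriv_eq, Real.deriv_rpow_const]
  norm_num

lemma deriv_deriv_profile_of_one_lt {s : ℝ} (hs : 1 < s) :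
    deriv (deriv profile) s = 3 / 4 * s ^ (-5 / 2 : ℝ) := by
  have : deriv profile =ᶠ[𝓝 s] fun t => -1 / 2 * t ^ (-3 / 2 : ℝ) := by
    filter_upwards [Ioi_mem_nhds hs] with t ht using deriv_profile_of_one_lt ht
  rw [this.deriv_eq, deriv_const_mul_field, Real.deriv_rpow_const]
  norm_num
  ring

/-- The Laplacian of `z ↦ profile (‖z‖ ^ 2)` in dimension three, as a function of `‖z‖`. -/
noncomputable def profileLap (s : ℝ) : ℝ :=
  6 * deriv profile (s ^ 2) + 4 * s ^ 2 * deriv (deriv profile) (s ^ 2)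

lemma continuous_profileLap : Continuous profileLap := by
  have h1 : Continuous (deriv profile) := (contDiff_deriv_profile (n := 0)).continuous
  have h2 := continuous_deriv_deriv_profile
  unfold profileLap
  fun_prop

lemma profileLap_of_lt {s : ℝ} (h0 : 0 ≤ s) (hs : s < 1 / 2) : profileLap s = 0 := by
  have : s ^ 2 < 1 / 4 := by nlinarith
  rw [profileLap, deriv_profile_of_lt this, deriv_deriv_profile_of_lt this]
  simp

lemma profileLap_of_one_lt {s : ℝ} (hs : 1 < s) : profileLap s = 0 := by
  have h : 1 < s ^ 2 := by nlinarith
  rw [profileLap, deriv_profile_of_one_lt h, deriv_deriv_profile_of_one_lt h]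
  have : (s ^ 2) ^ (-3 / 2 : ℝ) = s ^ 2 * (s ^ 2) ^ (-5 / 2 : ℝ) := by
    rw [← Real.rpow_one_add' (by positivity) (by norm_num)]
    norm_num
  rw [this]
  ring

lemma integral_sq_mul_profileLap : ∫ s in Ioi (0 : ℝ), s ^ 2 * profileLap s = -1 := by
  have hderiv : ∀ s ∈ Ioi (0 : ℝ),
      HasDerivAt (fun s : ℝ => 2 * s ^ 3 * deriv profile (s ^ 2)) (s ^ 2 * profileLap s) s := by
    intro s _
    have h := ((hasDerivAt_pow 3 s).const_mul 2).mul
      ((hasDerivAt_deriv_profile (s ^ 2)).comp s (hasDerivAt_pow 2 s))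
    refine h.congr_deriv ?_
    simp [profileLap]
    ring
  have hcont : Continuous fun s : ℝ => 2 * s ^ 3 * deriv profile (s ^ 2) := by
    have h1 : Continuous (deriv profile) := (contDiff_deriv_profile (n := 0)).continuous
    fun_prop
  have hf_int : IntegrableOn (fun s : ℝ => s ^ 2 * profileLap s) (Ioi 0) := by
    have hc : Continuous fun s : ℝ => s ^ 2 * profileLap s := by
      have := continuous_profileLap
      fun_prop
    rw [← Ioc_union_Ioi_eq_Ioi zero_le_one]
    refine (hc.integrableOn_Ioc).union ?_
    exact integrableOn_zero.congr_fun (fun s hs => by simp [profileLap_of_one_lt hs])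
      measurableSet_Ioi
  have hlim : Tendsto (fun s : ℝ => 2 * s ^ 3 * deriv profile (s ^ 2)) atTop (𝓝 (-1)) := by
    refine tendsto_const_nhds.congr' ?_
    filter_upwards [eventually_gt_atTop 1] with s hs
    have h : (s ^ 2) ^ (-3 / 2 : ℝ) = (s ^ 3)⁻¹ := by
      rw [← Real.rpow_natCast, ← Real.rpow_mul (by positivity), ← Real.rpow_natCast,
        ← Real.rpow_neg (by positivity)]
      norm_num
    rw [deriv_profile_of_one_lt (by nlinarith), h]
    field_simp
  rw [integral_Ioi_of_hasDerivAt_of_tendsto hcont.continuousWithinAt hderiv hf_int hlim]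
  simp

end Profile

section Kernel

/-- The trace of a bilinear form on `ℝ³`. -/
noncomputable def hessTrace :
    (EuclideanSpace ℝ (Fin 3) →L[ℝ] EuclideanSpace ℝ (Fin 3) →L[ℝ] ℝ) →L[ℝ] ℝ :=
  ∑ j : Fin 3, (ContinuousLinearMap.apply ℝ ℝ (EuclideanSpace.single j (1 : ℝ))).comp
    (ContinuousLinearMap.apply ℝ (EuclideanSpace ℝ (Fin 3) →L[ℝ] ℝ)
      (EuclideanSpace.single j (1 : ℝ)))

lemma hessTrace_apply (T : EuclideanSpace ℝ (Fin 3) →L[ℝ] EuclideanSpace ℝ (Fin 3) →L[ℝ] ℝ) :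
    hessTrace T = ∑ j : Fin 3, T (EuclideanSpace.single j 1) (EuclideanSpace.single j 1) := by
  simp [hessTrace]

lemma laplacian3_eq_hessTrace {f : EuclideanSpace ℝ (Fin 3) → ℝ} {x : EuclideanSpace ℝ (Fin 3)}
    {T : EuclideanSpace ℝ (Fin 3) →L[ℝ] EuclideanSpace ℝ (Fin 3) →L[ℝ] ℝ}
    (h : HasFDerivAt (fderiv ℝ f) T x) : laplacian3 f x = hessTrace T := by
  rw [laplacian3, hessTrace_apply]
  refine Finset.sum_congr rfl fun j _ => ?_
  have := (h.clm_apply (hasFDerivAt_const (EuclideanSpace.single j (1 : ℝ)) x)).fderiv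
  rw [this]
  simp

/-- The Newtonian kernel `1 / ‖z‖`, regularised in the unit ball. -/
noncomputable def regKernel (z : EuclideanSpace ℝ (Fin 3)) : ℝ := profile (‖z‖ ^ 2)

/-- The difference of the regularised kernels at two consecutive dyadic scales. -/
noncomputable def dyadicKernel (z : EuclideanSpace ℝ (Fin 3)) : ℝ :=
  2 * regKernel ((2 : ℝ) • z) - regKernel z

lemma contDiff_regKernel {n : ℕ∞} : ContDiff ℝ n regKernel :=
  contDiff_profile.comp (contDiff_norm_sq ℝ)

lemma regKernel_of_le {z : EuclideanSpace ℝ (Fin 3)} (hz : ‖z‖ ≤ 1 / 2) : regKernel z = 0 :=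
  profile_of_le (by nlinarith [norm_nonneg z])

lemma regKernel_of_one_le {z : EuclideanSpace ℝ (Fin 3)} (hz : 1 ≤ ‖z‖) :
    regKernel z = ‖z‖⁻¹ :=
  profile_sq_of_one_le hz

lemma abs_regKernel_le (z : EuclideanSpace ℝ (Fin 3)) : |regKernel z| ≤ ‖z‖⁻¹ := by
  simpa [regKernel] using abs_profile_sq_le ‖z‖

lemma contDiff_dyadicKernel {n : ℕ∞} : ContDiff ℝ n dyadicKernel :=
  (contDiff_const.mul (contDiff_regKernel.comp (contDiff_const_smul _))).sub contDiff_regKernel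

lemma tsupport_dyadicKernel_subset : tsupport dyadicKernel ⊆ closedBall 0 1 := by
  refine closure_minimal (fun z hz => ?_) isClosed_closedBall
  rw [mem_closedBall_zero_iff]
  by_contra! h
  refine hz ?_
  have h2 : ‖(2 : ℝ) • z‖ = 2 * ‖z‖ := by simp [norm_smul]
  rw [dyadicKernel, regKernel_of_one_le h.le, regKernel_of_one_le (by rw [h2]; linarith), h2]
  field_simp
  simp

lemma fderiv_regKernel (z : EuclideanSpace ℝ (Fin 3)) :
    fderiv ℝ regKernel z = deriv profile (‖z‖ ^ 2) • (2 • innerSL ℝ z) :=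
  ((hasDerivAt_profile (‖z‖ ^ 2)).comp_hasFDerivAt z
    (hasStrictFDerivAt_norm_sq z).hasFDerivAt).fderiv

lemma hasFDerivAt_fderiv_regKernel (z : EuclideanSpace ℝ (Fin 3)) :
    HasFDerivAt (fderiv ℝ regKernel) (fderiv ℝ (fderiv ℝ regKernel) z) z := by
  have h : ContDiff ℝ 1 (fderiv ℝ regKernel) :=
    (contDiff_regKernel (n := 2)).fderiv_right (by norm_num)
  exact (h.differentiable one_ne_zero z).hasFDerivAt

lemma laplacian3_regKernel (z : EuclideanSpace ℝ (Fin 3)) :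
    laplacian3 regKernel z = profileLap ‖z‖ := by
  have key : ∀ j : Fin 3, fderiv ℝ (fun y => fderiv ℝ regKernel y (EuclideanSpace.single j 1)) z
      (EuclideanSpace.single j 1) =
      2 * deriv profile (‖z‖ ^ 2) + 4 * deriv (deriv profile) (‖z‖ ^ 2) * z j ^ 2 := by
    intro j
    have h1 : (fun y => fderiv ℝ regKernel y (EuclideanSpace.single j 1)) =
        fun y : EuclideanSpace ℝ (Fin 3) => deriv profile (‖y‖ ^ 2) * (2 * y j) := by
      ext y
      simp [fderiv_regKernel, EuclideanSpace.inner_single_right]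
    have h2 := ((hasDerivAt_deriv_profile (‖z‖ ^ 2)).comp_hasFDerivAt z
      (hasStrictFDerivAt_norm_sq z).hasFDerivAt).mul
      (((EuclideanSpace.proj j : EuclideanSpace ℝ (Fin 3) →L[ℝ] ℝ).hasFDerivAt
        (x := z)).const_mul 2)
    rw [h1, HasFDerivAt.fderiv (f := fun y : EuclideanSpace ℝ (Fin 3) =>
      deriv profile (‖y‖ ^ 2) * (2 * y j)) h2]
    simp [EuclideanSpace.inner_single_right]
    ring
  rw [laplacian3, Finset.sum_congr rfl fun j _ => key j, Finset.sum_add_distrib, ← Finset.mul_sum,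
    ← Finset.mul_sum, profileLap, ← EuclideanSpace.real_norm_sq_eq]
  simp
  ring

lemma hasFDerivAt_fderiv_dyadicKernel (z : EuclideanSpace ℝ (Fin 3)) :
    HasFDerivAt (fderiv ℝ dyadicKernel)
      ((8 : ℝ) • fderiv ℝ (fderiv ℝ regKernel) ((2 : ℝ) • z) -
        fderiv ℝ (fderiv ℝ regKernel) z) z := by
  have h1 : fderiv ℝ dyadicKernel = fun z => (4 : ℝ) • fderiv ℝ regKernel ((2 : ℝ) • z) -
      fderiv ℝ regKernel z := by
    ext1 z
    have hd : Differentiable ℝ regKernel :=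
      (contDiff_regKernel (n := 1)).differentiable (by norm_num)
    have hd2 : DifferentiableAt ℝ (fun z => regKernel ((2 : ℝ) • z)) z := by fun_prop
    unfold dyadicKernel
    rw [fderiv_fun_sub (by fun_prop) (by fun_prop), fderiv_const_mul hd2, fderiv_comp_smul,
      smul_smul]
    norm_num
  rw [h1]
  have h2 := (((hasFDerivAt_fderiv_regKernel ((2 : ℝ) • z)).comp z
    ((hasFDerivAt_id z).const_smul (2 : ℝ))).const_smul (4 : ℝ)).sub
    (hasFDerivAt_fderiv_regKernel z)
  refine h2.congr_fderiv ?_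
  ext v w
  simp
  ring

lemma hessTrace_dyadicKernel (z : EuclideanSpace ℝ (Fin 3)) :
    hessTrace (fderiv ℝ (fderiv ℝ dyadicKernel) z) =
      8 * profileLap ‖(2 : ℝ) • z‖ - profileLap ‖z‖ := by
  rw [(hasFDerivAt_fderiv_dyadicKernel z).fderiv, ← laplacian3_regKernel,
    ← laplacian3_regKernel, laplacian3_eq_hessTrace (hasFDerivAt_fderiv_regKernel _),
    laplacian3_eq_hessTrace (hasFDerivAt_fderiv_regKernel _)]
  simp only [hessTrace_apply, Finset.mul_sum, ← Finset.sum_sub_distrib]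
  rfl

lemma integral_profileLap :
    ∫ z : EuclideanSpace ℝ (Fin 3), profileLap ‖z‖ = -(4 * Real.pi) := by
  rw [integral_fun_norm_addHaar volume profileLap]
  simp only [finrank_euclideanSpace_fin, smul_eq_mul, nsmul_eq_mul]
  rw [integral_sq_mul_profileLap, Measure.real, EuclideanSpace.volume_ball_fin_three]
  have h : (0 : ℝ) ≤ Real.pi * 4 / 3 := by positivity
  simp [ENNReal.toReal_ofReal h]
  ring

end Kernel

section Representation

variable {f : EuclideanSpace ℝ (Fin 3) → ℝ} {M H α r R : ℝ}

lemma integrable_mul_comp_dilation (hf : Continuous f) (hfs : HasCompactSupport f)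
    {ψ : EuclideanSpace ℝ (Fin 3) → ℝ} (hψ : Continuous ψ) (r : ℝ)
    (x : EuclideanSpace ℝ (Fin 3)) : Integrable fun t => f t • ψ (r • (x - t)) :=
  Continuous.integrable_of_hasCompactSupport (by fun_prop) hfs.smul_right

lemma sum_dilConv_telescope (hf : Continuous f) (hfs : HasCompactSupport f)
    {ψ φ : EuclideanSpace ℝ (Fin 3) → ℝ} (hψ : Continuous ψ) (k : ℕ)
    (hφ : ∀ z, φ z = 2 ^ k * ψ ((2 : ℝ) • z) - ψ z) (r : ℝ)
    (x : EuclideanSpace ℝ (Fin 3)) (N : ℕ) :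
    ∑ n ∈ Finset.range N, (2 ^ n * r) ^ k • dilConv f φ (2 ^ n * r) x =
      (2 ^ N * r) ^ k * dilConv f ψ (2 ^ N * r) x - r ^ k * dilConv f ψ r x := by
  have step : ∀ s : ℝ, s ^ k • dilConv f φ s x =
      (2 * s) ^ k * dilConv f ψ (2 * s) x - s ^ k * dilConv f ψ s x := by
    intro s
    have h : dilConv f φ s x = 2 ^ k * dilConv f ψ (2 * s) x - dilConv f ψ s x := by
      simp only [dilConv]
      rw [← integral_const_mul, ← integral_sub
        ((integrable_mul_comp_dilation hf hfs hψ (2 * s) x).const_mul _)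
        (integrable_mul_comp_dilation hf hfs hψ s x)]
      refine integral_congr_ae (.of_forall fun t => ?_)
      simp only [hφ, smul_smul, smul_eq_mul]
      ring
    rw [h, smul_eq_mul]
    ring
  rw [Finset.sum_congr rfl fun n _ => step (2 ^ n * r),
    Finset.sum_congr (g := fun n => (2 ^ (n + 1) * r) ^ k * dilConv f ψ (2 ^ (n + 1) * r) x -
      (2 ^ n * r) ^ k * dilConv f ψ (2 ^ n * r) x) rfl fun n _ => by
      rw [← mul_assoc, ← pow_succ'],
    Finset.sum_range_sub fun n => (2 ^ n * r) ^ k * dilConv f ψ (2 ^ n * r) x]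
  simp

lemma dilConv_eq_zero {ψ : EuclideanSpace ℝ (Fin 3) → ℝ} (hψ : ∀ z, ‖z‖ < 1 / 2 → ψ z = 0)
    (hR : 0 < R) (hfR : ∀ x, R ≤ ‖x‖ → f x = 0) {x : EuclideanSpace ℝ (Fin 3)} (hx : ‖x‖ < R) :
    dilConv f ψ (4 * R)⁻¹ x = 0 := by
  refine integral_eq_zero_of_ae (.of_forall fun t => ?_)
  rcases lt_or_ge ‖t‖ R with ht | ht
  · have : ψ ((4 * R)⁻¹ • (x - t)) = 0 := by
      refine hψ _ ?_
      rw [norm_smul, Real.norm_of_nonneg (by positivity), inv_mul_lt_iff₀ (by positivity)]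
      linarith [norm_sub_le x t]
    beta_reduce
    rw [this, smul_zero, Pi.zero_apply]
  · simp [hfR t ht]

lemma tendsto_two_pow_mul (hr : 0 < r) : Tendsto (fun n : ℕ => 2 ^ n * r) atTop atTop :=
  (tendsto_pow_atTop_atTop_of_one_lt one_lt_two).atTop_mul_const hr

lemma tendsto_mul_regKernel (z : EuclideanSpace ℝ (Fin 3)) :
    Tendsto (fun s : ℝ => s * regKernel (s • z)) atTop (𝓝 ‖z‖⁻¹) := by
  rcases eq_or_ne z 0 with rfl | hz
  · simp [regKernel_of_le]
  · refine tendsto_const_nhds.congr' ?_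
    have hz' := norm_pos_iff.2 hz
    filter_upwards [eventually_ge_atTop ‖z‖⁻¹, eventually_gt_atTop 0] with s hs hs0
    have h : ‖s • z‖ = s * ‖z‖ := by rw [norm_smul, Real.norm_of_nonneg hs0.le]
    rw [regKernel_of_one_le (by rw [h]; rwa [inv_le_iff_one_le_mul₀ hz'] at hs), h]
    field_simp

lemma tendsto_mul_dilConv_regKernel (hf : Continuous f)
    (x : EuclideanSpace ℝ (Fin 3)) (hf_int : Integrable fun t => f t / ‖x - t‖) :
    Tendsto (fun s : ℝ => s * dilConv f regKernel s x) atTop (𝓝 (∫ t, f t / ‖x - t‖)) := by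
  have hc : Continuous regKernel := (contDiff_regKernel (n := 0)).continuous
  simp only [dilConv, ← integral_const_mul]
  refine tendsto_integral_filter_of_dominated_convergence (fun t => ‖f t / ‖x - t‖‖)
    (.of_forall fun s => Continuous.aestronglyMeasurable (by fun_prop)) ?_ hf_int.norm
    (.of_forall fun t => ?_)
  · filter_upwards [eventually_gt_atTop 0] with s hs
    refine .of_forall fun t => ?_
    have h := abs_regKernel_le (s • (x - t))
    rw [norm_smul, Real.norm_of_nonneg hs.le, mul_inv] at h
    rw [smul_eq_mul, mul_left_comm, norm_mul, norm_div, norm_norm, div_eq_mul_inv, norm_mul,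
      Real.norm_of_nonneg hs.le, Real.norm_eq_abs (regKernel _)]
    refine mul_le_mul_of_nonneg_left ?_ (norm_nonneg _)
    calc s * |regKernel (s • (x - t))| ≤ s * (s⁻¹ * ‖x - t‖⁻¹) := by gcongr
      _ = ‖x - t‖⁻¹ := by field_simp
  · simp only [smul_eq_mul, div_eq_mul_inv]
    exact ((tendsto_mul_regKernel (x - t)).const_mul (f t)).congr fun s => by ring

lemma hasCompactSupport_of_forall_le_norm (hfR : ∀ x, R ≤ ‖x‖ → f x = 0) :
    HasCompactSupport f :=
  HasCompactSupport.intro (isCompact_closedBall 0 R) fun x hx => hfR x (by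
    rw [mem_closedBall_zero_iff] at hx; exact (not_le.1 hx).le)

lemma integral_div_norm_eq_dyadicSum (hf : Continuous f) (hfM : ∀ x, |f x| ≤ M) (hR : 0 < R)
    (hfR : ∀ x, R ≤ ‖x‖ → f x = 0) {x : EuclideanSpace ℝ (Fin 3)} (hx : ‖x‖ < R)
    (hf_int : Integrable fun t => f t / ‖x - t‖) :
    ∫ t, f t / ‖x - t‖ = dyadicSum 1 f dyadicKernel (4 * R)⁻¹ x := by
  have hfs := hasCompactSupport_of_forall_le_norm hfR
  have hr : 0 < (4 * R)⁻¹ := by positivity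
  have hφs : HasCompactSupport dyadicKernel :=
    (isCompact_closedBall 0 1).of_isClosed_subset (isClosed_tsupport _)
      tsupport_dyadicKernel_subset
  have hs := (summable_dyadicSum finrank_euclideanSpace_fin hr hfM hφs
    (contDiff_dyadicKernel (n := 0)).continuous x).hasSum.tendsto_sum_nat
  refine tendsto_nhds_unique ?_ hs
  have h := (tendsto_mul_dilConv_regKernel hf x hf_int).comp (tendsto_two_pow_mul hr)
  refine h.congr fun N => ?_
  rw [sum_dilConv_telescope hf hfs (contDiff_regKernel (n := 0)).continuous 1
    (fun z => by rw [pow_one]; rfl), dilConv_eq_zero (fun z hz => regKernel_of_le hz.le) hR hfR hx]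
  simp

lemma tendsto_cube_mul_dilConv (hf : Continuous f) (hα : 0 < α) (hH : 0 ≤ H)
    (hfH : ∀ x y, |f x - f y| ≤ H * ‖x - y‖ ^ α) {ψ : EuclideanSpace ℝ (Fin 3) → ℝ}
    (hψ : Continuous ψ) (hψ1 : ∀ z, 1 < ‖z‖ → ψ z = 0) (x : EuclideanSpace ℝ (Fin 3)) :
    Tendsto (fun s : ℝ => s ^ 3 * dilConv f ψ s x) atTop (𝓝 (f x * ∫ z, ψ z)) := by
  have hψs : HasCompactSupport ψ := HasCompactSupport.intro (isCompact_closedBall 0 1)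
    fun z hz => hψ1 z (by rw [mem_closedBall_zero_iff] at hz; exact not_le.1 hz)
  rw [tendsto_iff_norm_sub_tendsto_zero]
  have hlim : Tendsto (fun s : ℝ => H * s⁻¹ ^ α * ∫ z, ‖ψ z‖) atTop (𝓝 0) := by
    have h1 : Tendsto (fun s : ℝ => s⁻¹ ^ α) atTop (𝓝 0) := by
      have := tendsto_inv_atTop_zero.rpow_const (p := α) (.inr hα.le)
      rwa [Real.zero_rpow hα.ne'] at this
    simpa using (h1.const_mul H).mul_const (∫ z, ‖ψ z‖)
  refine squeeze_zero' (.of_forall fun _ => norm_nonneg _) ?_ hlim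
  filter_upwards [eventually_gt_atTop 0] with s hs
  have h := norm_dilConv_sub_le finrank_euclideanSpace_fin hf hα.le hH hfH hψ1 hψs hψ hs x
  have h3 : 0 < s ^ 3 := by positivity
  have e : s ^ 3 * dilConv f ψ s x - f x * ∫ z, ψ z =
      s ^ 3 * (dilConv f ψ s x - f x • (s ^ 3)⁻¹ • ∫ z, ψ z) := by
    simp only [smul_eq_mul]
    field_simp
  rw [e, norm_mul, Real.norm_of_nonneg h3.le]
  refine (mul_le_mul_of_nonneg_left h h3.le).trans_eq ?_
  field_simp

lemma hessTrace_dyadicSum (hf : Continuous f) (hα : 0 < α) (hH : 0 ≤ H)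
    (hfH : ∀ x y, |f x - f y| ≤ H * ‖x - y‖ ^ α) (hR : 0 < R) (hfR : ∀ x, R ≤ ‖x‖ → f x = 0)
    {x : EuclideanSpace ℝ (Fin 3)} (hx : ‖x‖ < R) :
    hessTrace (dyadicSum 3 f (fderiv ℝ (fderiv ℝ dyadicKernel)) (4 * R)⁻¹ x) =
      -(4 * Real.pi) * f x := by
  have hfs := hasCompactSupport_of_forall_le_norm hfR
  have hr : 0 < (4 * R)⁻¹ := by positivity
  have h1 : ContDiff ℝ 1 (fderiv ℝ dyadicKernel) :=
    (contDiff_dyadicKernel (n := 2)).fderiv_right (by norm_num)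
  have hs := (hasSum_clm_dyadicSum hessTrace finrank_euclideanSpace_fin hf hα hH hfH
    ((tsupport_fderiv_subset ℝ).trans tsupport_dyadicKernel_subset) h1 hr x).tendsto_sum_nat
  simp only [hessTrace_dyadicKernel] at hs
  refine tendsto_nhds_unique hs ?_
  have hc : Continuous fun z : EuclideanSpace ℝ (Fin 3) => profileLap ‖z‖ :=
    continuous_profileLap.comp continuous_norm
  have h := (tendsto_cube_mul_dilConv hf hα hH hfH hc
    (fun z hz => profileLap_of_one_lt hz) x).comp (tendsto_two_pow_mul hr)
  rw [integral_profileLap, mul_comm (f x)] at h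
  refine h.congr fun N => ?_
  have hsum := sum_dilConv_telescope hf hfs hc 3
    (φ := fun z => 8 * profileLap ‖(2 : ℝ) • z‖ - profileLap ‖z‖) (fun _ => by norm_num)
    (4 * R)⁻¹ x N
  rw [dilConv_eq_zero (fun z hz => profileLap_of_lt (norm_nonneg z) hz) hR hfR hx, mul_zero,
    sub_zero] at hsum
  rw [Function.comp_apply, ← hsum]

/-- The Newtonian potential of a compactly supported Hölder continuous density is `C²`
and solves the Poisson equation. -/
theorem poisson_of_holder (hf : Continuous f) (hfM : ∀ x, |f x| ≤ M) (hα : 0 < α) (hH : 0 ≤ H)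
    (hfH : ∀ x y, |f x - f y| ≤ H * ‖x - y‖ ^ α) (hR : 0 < R) (hfR : ∀ x, R ≤ ‖x‖ → f x = 0)
    (hf_int : ∀ x, Integrable fun t => f t / ‖x - t‖) :
    ContDiffOn ℝ 2 (fun x => ∫ t, f t / ‖x - t‖) (ball 0 R) ∧
    ∀ x, ‖x‖ < R → laplacian3 (fun x => ∫ t, f t / ‖x - t‖) x = -(4 * Real.pi) * f x := by
  have hr : 0 < (4 * R)⁻¹ := by positivity
  have hE : EqOn (fun x => ∫ t, f t / ‖x - t‖) (dyadicSum 1 f dyadicKernel (4 * R)⁻¹)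
      (ball 0 R) := fun x hx =>
    integral_div_norm_eq_dyadicSum hf hfM hR hfR (mem_ball_zero_iff.1 hx) (hf_int x)
  refine ⟨(contDiff_dyadicSum finrank_euclideanSpace_fin hf hfM hα hH hfH
    tsupport_dyadicKernel_subset (contDiff_dyadicKernel (n := 3)) hr).contDiffOn.congr hE,
    fun x hx => ?_⟩
  have hx' : ball 0 R ∈ 𝓝 x := isOpen_ball.mem_nhds (mem_ball_zero_iff.2 hx)
  rw [← hessTrace_dyadicSum hf hα hH hfH hR hfR hx]
  exact laplacian3_eq_hessTrace <| (hasFDerivAt_fderiv_dyadicSum finrank_euclideanSpace_fin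
    hf hfM hα hH hfH
    tsupport_dyadicKernel_subset (contDiff_dyadicKernel (n := 3)) hr x).congr_of_eventuallyEq
    (hE.eventuallyEq_of_mem hx').fderiv

end Representation

section KernelBounds

lemma integrableOn_inv_norm_sq (ρ : ℝ) :
    IntegrableOn (fun z : EuclideanSpace ℝ (Fin 3) => (‖z‖ ^ 2)⁻¹) (closedBall 0 ρ) := by
  have h : IntegrableOn (fun z : EuclideanSpace ℝ (Fin 3) => (‖z‖ ^ 2)⁻¹) (ball 0 (ρ + 1)) := by
    refine (integrableOn_fun_norm_addHaar volume (f := fun s : ℝ => (s ^ 2)⁻¹)).2 ?_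
    rw [finrank_euclideanSpace_fin]
    refine (integrableOn_const (μ := volume) (s := Ioo (0 : ℝ) (ρ + 1)) (C := (1 : ℝ))
      (by simp)).congr_fun
      (fun s hs => ?_) measurableSet_Ioo
    have : s ≠ 0 := hs.1.ne'
    simp [this]
  exact h.mono_set (closedBall_subset_ball (by linarith))

/-- A truncated integrable kernel which dominates both `1 / ‖z‖` and `1 / ‖z‖ ^ 2`. -/
noncomputable def majorant (ρ : ℝ) : EuclideanSpace ℝ (Fin 3) → ℝ :=
  (closedBall 0 ρ).indicator fun z => 1 + (‖z‖ ^ 2)⁻¹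

lemma integrable_majorant (ρ : ℝ) : Integrable (majorant ρ) :=
  (((integrableOn_const (C := (1 : ℝ)) measure_closedBall_lt_top.ne).add
    (integrableOn_inv_norm_sq ρ)).integrable_indicator measurableSet_closedBall :)

lemma majorant_nonneg (ρ : ℝ) (z : EuclideanSpace ℝ (Fin 3)) : 0 ≤ majorant ρ z :=
  indicator_nonneg (fun z _ => by positivity) z

lemma inv_le_one_add_sq_inv (a : ℝ) : a⁻¹ ≤ 1 + (a ^ 2)⁻¹ := by
  rw [← inv_pow]
  nlinarith [sq_nonneg (a⁻¹ - 1), sq_nonneg a⁻¹]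

lemma abs_inv_sub_inv_le {a b d : ℝ} (ha : 0 ≤ a) (hb : 0 ≤ b) (hd : |a - b| ≤ d) :
    |a⁻¹ - b⁻¹| ≤ d * ((a ^ 2)⁻¹ + (b ^ 2)⁻¹) := by
  refine le_trans ?_ (mul_le_mul_of_nonneg_right hd (by positivity))
  rcases ha.eq_or_lt with rfl | ha
  · rcases hb.eq_or_lt with rfl | hb
    · simp
    · simp only [inv_zero, zero_sub, abs_neg, abs_of_pos hb, abs_of_pos (inv_pos.2 hb)]
      field_simp
      simp
  rcases hb.eq_or_lt with rfl | hb
  · simp only [inv_zero, sub_zero, abs_of_pos ha, abs_of_pos (inv_pos.2 ha)]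
    field_simp
    simp
  have h : a⁻¹ - b⁻¹ = -((a - b) * (a⁻¹ * b⁻¹)) := by
    field_simp
    ring
  rw [h, abs_neg, abs_mul, abs_of_nonneg (by positivity : 0 ≤ a⁻¹ * b⁻¹), ← inv_pow, ← inv_pow]
  refine mul_le_mul_of_nonneg_left ?_ (abs_nonneg _)
  nlinarith [sq_nonneg (a⁻¹ - b⁻¹), sq_nonneg a⁻¹, sq_nonneg b⁻¹]

variable {f : EuclideanSpace ℝ (Fin 3) → ℝ} {M R : ℝ}

lemma integrable_div_norm_sub (hf : AEStronglyMeasurable f) (hfM : ∀ t, |f t| ≤ M)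
    (hfR : ∀ t, R ≤ ‖t‖ → f t = 0) (x : EuclideanSpace ℝ (Fin 3)) :
    Integrable fun t => f t / ‖x - t‖ := by
  have hM : 0 ≤ M := (abs_nonneg _).trans (hfM 0)
  refine (((integrable_majorant (‖x‖ + R)).comp_sub_left x).const_mul M).mono'
    (hf.aemeasurable.div (by fun_prop)).aestronglyMeasurable (.of_forall fun t => ?_)
  rcases le_or_gt R ‖t‖ with ht | ht
  · rw [hfR t ht, zero_div, norm_zero]
    exact mul_nonneg hM (majorant_nonneg _ _)
  · have hm : x - t ∈ closedBall (0 : EuclideanSpace ℝ (Fin 3)) (‖x‖ + R) := by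
      rw [mem_closedBall_zero_iff]
      linarith [norm_sub_le x t]
    rw [majorant, indicator_of_mem hm, norm_div, norm_norm, div_eq_mul_inv]
    exact mul_le_mul (hfM t) (inv_le_one_add_sq_inv _) (by positivity) hM

lemma abs_integral_div_norm_sub_le (hf : AEStronglyMeasurable f) (hfM : ∀ t, |f t| ≤ M)
    (hfR : ∀ t, R ≤ ‖t‖ → f t = 0) {x y : EuclideanSpace ℝ (Fin 3)} (hx : ‖x‖ ≤ R)
    (hy : ‖y‖ ≤ R) :
    |(∫ t, f t / ‖x - t‖) - ∫ t, f t / ‖y - t‖| ≤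
      (2 * ∫ z, majorant (2 * R) z) * M * ‖x - y‖ := by
  have hM : 0 ≤ M := (abs_nonneg _).trans (hfM 0)
  have hi := fun x => (integrable_majorant (2 * R)).comp_sub_left x
  rw [← integral_sub (integrable_div_norm_sub hf hfM hfR x) (integrable_div_norm_sub hf hfM hfR y)]
  have e : (2 * ∫ z, majorant (2 * R) z) * M * ‖x - y‖ =
      ∫ t, M * ‖x - y‖ * (majorant (2 * R) (x - t) + majorant (2 * R) (y - t)) := by
    rw [integral_const_mul, integral_add (hi x) (hi y),
      integral_sub_left_eq_self (majorant (2 * R)) volume x,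
      integral_sub_left_eq_self (majorant (2 * R)) volume y]
    ring
  rw [e, ← Real.norm_eq_abs]
  refine norm_integral_le_of_norm_le (((hi x).add (hi y)).const_mul _) (.of_forall fun t => ?_)
  rcases le_or_gt R ‖t‖ with ht | ht
  · rw [hfR t ht, zero_div, zero_div, sub_zero, norm_zero]
    exact mul_nonneg (by positivity) (add_nonneg (majorant_nonneg _ _) (majorant_nonneg _ _))
  · have hm : ∀ x : EuclideanSpace ℝ (Fin 3), ‖x‖ ≤ R →
        (‖x - t‖ ^ 2)⁻¹ ≤ majorant (2 * R) (x - t) := fun x hx => by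
      have : x - t ∈ closedBall (0 : EuclideanSpace ℝ (Fin 3)) (2 * R) := by
        rw [mem_closedBall_zero_iff]
        linarith [norm_sub_le x t]
      rw [majorant, indicator_of_mem this]
      linarith
    have hd : |‖x - t‖ - ‖y - t‖| ≤ ‖x - y‖ := by
      simpa using abs_norm_sub_norm_le (x - t) (y - t)
    rw [div_eq_mul_inv, div_eq_mul_inv, ← mul_sub, norm_mul, mul_assoc]
    refine mul_le_mul (hfM t) ?_ (norm_nonneg _) hM
    exact (abs_inv_sub_inv_le (norm_nonneg _) (norm_nonneg _) hd).trans
      (mul_le_mul_of_nonneg_left (add_le_add (hm x hx) (hm y hy)) (norm_nonneg _))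

end KernelBounds

section Newton

variable {χ : ℝ → ℝ} {f g : EuclideanSpace ℝ (Fin 3) → ℝ} {M R : ℝ}

lemma aestronglyMeasurable_mul_cutoff (hχ : Continuous χ) (hχ0 : ∀ η, R ≤ η → χ η = 0)
    (hf : ContinuousOn f (closedBall 0 R)) :
    AEStronglyMeasurable fun t => f t * χ ‖t‖ := by
  have h : (fun t => f t * χ ‖t‖) = (closedBall 0 R).indicator fun t => f t * χ ‖t‖ := by
    refine (indicator_eq_self.2 fun t ht => ?_).symm
    rw [mem_closedBall_zero_iff]
    by_contra! hc
    exact ht (by simp only [hχ0 _ hc.le, mul_zero])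
  rw [h, aestronglyMeasurable_indicator_iff measurableSet_closedBall]
  exact (hf.mul (by fun_prop)).aestronglyMeasurable measurableSet_closedBall

lemma abs_mul_cutoff_le (hχb : ∀ η, 0 ≤ χ η ∧ χ η ≤ 1) (hχ0 : ∀ η, R ≤ η → χ η = 0)
    (hM : 0 ≤ M) (hfM : ∀ x ∈ closedBall (0 : EuclideanSpace ℝ (Fin 3)) R, |f x| ≤ M)
    (t : EuclideanSpace ℝ (Fin 3)) : |f t * χ ‖t‖| ≤ M := by
  rcases le_or_gt R ‖t‖ with ht | ht
  · simpa [hχ0 _ ht] using hM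
  · rw [abs_mul, abs_of_nonneg (hχb _).1]
    exact (mul_le_of_le_one_right (abs_nonneg _) (hχb _).2).trans
      (hfM t (mem_closedBall_zero_iff.2 ht.le))

lemma integrable_newton3 (hχ : Continuous χ) (hχb : ∀ η, 0 ≤ χ η ∧ χ η ≤ 1)
    (hχ0 : ∀ η, R ≤ η → χ η = 0) (hf : ContinuousOn f (closedBall 0 R))
    (x : EuclideanSpace ℝ (Fin 3)) : Integrable fun t => f t * χ ‖t‖ / ‖x - t‖ := by
  obtain ⟨M, hM⟩ :=
    (isCompact_closedBall (0 : EuclideanSpace ℝ (Fin 3)) R).exists_bound_of_continuousOn hf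
  exact integrable_div_norm_sub (aestronglyMeasurable_mul_cutoff hχ hχ0 hf)
    (abs_mul_cutoff_le hχb hχ0 (le_max_right M 0) fun x hx => (hM x hx).trans (le_max_left M 0))
    (fun t ht => by rw [hχ0 _ ht, mul_zero]) x

lemma newton3'_congr (hχ0 : ∀ η, R ≤ η → χ η = 0) (h : EqOn f g (closedBall 0 R)) :
    newton3' χ f = newton3' χ g := by
  have : (fun t => f t * χ ‖t‖) = fun t => g t * χ ‖t‖ := by
    ext t
    rcases le_or_gt R ‖t‖ with ht | ht
    · rw [hχ0 _ ht, mul_zero, mul_zero]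
    · rw [h (mem_closedBall_zero_iff.2 ht.le)]
  ext x
  simp only [newton3', newton3, congrFun this]

lemma newton3'_add (hχ : Continuous χ) (hχb : ∀ η, 0 ≤ χ η ∧ χ η ≤ 1)
    (hχ0 : ∀ η, R ≤ η → χ η = 0) (hf : ContinuousOn f (closedBall 0 R))
    (hg : ContinuousOn g (closedBall 0 R)) (x : EuclideanSpace ℝ (Fin 3)) :
    newton3' χ (fun t => f t + g t) x = newton3' χ f x + newton3' χ g x := by
  simp only [newton3', newton3, add_mul, add_div]
  rw [integral_add (integrable_newton3 hχ hχb hχ0 hf x) (integrable_newton3 hχ hχb hχ0 hg x),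
    integral_add (integrable_newton3 hχ hχb hχ0 hf 0) (integrable_newton3 hχ hχb hχ0 hg 0)]
  ring

lemma newton3'_const_mul (c : ℝ) (x : EuclideanSpace ℝ (Fin 3)) :
    newton3' χ (fun t => c * f t) x = c * newton3' χ f x := by
  simp only [newton3', newton3, mul_assoc, mul_div_assoc, integral_const_mul]
  ring

lemma newton3'_zero_right : newton3' χ f 0 = 0 := sub_self _

/-- The Lipschitz constant of the cut-off Newtonian potential on the ball of radius `R`. -/
noncomputable def newtonConst (R : ℝ) : ℝ :=
  1 / (4 * Real.pi) * (2 * ∫ z, majorant (2 * R) z)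

lemma newtonConst_nonneg (R : ℝ) : 0 ≤ newtonConst R :=
  mul_nonneg (by positivity) (mul_nonneg zero_le_two (integral_nonneg (majorant_nonneg _)))

lemma abs_newton3'_sub_le (hχ : Continuous χ) (hχb : ∀ η, 0 ≤ χ η ∧ χ η ≤ 1)
    (hχ0 : ∀ η, R ≤ η → χ η = 0) (hf : ContinuousOn f (closedBall 0 R)) (hM : 0 ≤ M)
    (hfM : ∀ x ∈ closedBall (0 : EuclideanSpace ℝ (Fin 3)) R, |f x| ≤ M)
    {x y : EuclideanSpace ℝ (Fin 3)} (hx : x ∈ closedBall 0 R) (hy : y ∈ closedBall 0 R) :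
    |newton3' χ f x - newton3' χ f y| ≤ newtonConst R * M * ‖x - y‖ := by
  have h := abs_integral_div_norm_sub_le (aestronglyMeasurable_mul_cutoff hχ hχ0 hf)
    (abs_mul_cutoff_le hχb hχ0 hM hfM) (fun t ht => by rw [hχ0 _ ht, mul_zero])
    (mem_closedBall_zero_iff.1 hx) (mem_closedBall_zero_iff.1 hy)
  rw [newton3', newton3', sub_sub_sub_cancel_right, newton3, newton3, ← mul_sub, abs_mul,
    abs_of_nonneg (by positivity : 0 ≤ 1 / (4 * Real.pi))]
  refine (mul_le_mul_of_nonneg_left h (by positivity)).trans_eq ?_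
  rw [newtonConst]
  ring

end Newton

section Fredholm

lemma isCompactOperator_of_lipschitz {X E : Type*} [MetricSpace X] [CompactSpace X]
    [NormedAddCommGroup E] [NormedSpace ℝ E] (T : E →L[ℝ] C(X, ℝ)) {L : ℝ}
    (hT : ∀ h x y, |T h x - T h y| ≤ L * ‖h‖ * dist x y) : IsCompactOperator T := by
  refine (isCompactOperator_iff_image_closedBall_subset_compact (T : E →ₗ[ℝ] C(X, ℝ)) one_pos).2 ?_
  have hL : ∀ h ∈ closedBall (0 : E) 1, L * ‖h‖ ≤ |L| := fun h hh =>
    (mul_le_mul_of_nonneg_right (le_abs_self L) (norm_nonneg _)).trans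
      (mul_le_of_le_one_right (abs_nonneg _) (mem_closedBall_zero_iff.1 hh))
  refine ⟨{f | (∀ x, f x ∈ closedBall (0 : ℝ) ‖T‖) ∧ ∀ x y, |f x - f y| ≤ |L| * dist x y},
    ArzelaAscoli.isCompact_of_equicontinuous _ ?_ ?_, ?_⟩
  · have hc : IsClosed {f : X → ℝ | ∀ x y, |f x - f y| ≤ |L| * dist x y} := by
      simp only [ofPred_forall]
      exact isClosed_iInter fun x => isClosed_iInter fun y =>
        isClosed_le (by fun_prop) continuous_const
    convert (isCompact_univ_pi fun _ : X => isCompact_closedBall (0 : ℝ) ‖T‖).inter_right hc using 1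
    ext f
    constructor
    · rintro ⟨f, hf, rfl⟩
      exact ⟨fun x _ => hf.1 x, hf.2⟩
    · rintro ⟨hf, hf'⟩
      have hLip : LipschitzWith (Real.nnabs L) f :=
        LipschitzWith.of_dist_le_mul fun x y => by
          rw [Real.dist_eq]
          exact hf' x y
      exact ⟨⟨f, hLip.continuous⟩, ⟨fun x => hf x (mem_univ x), hf'⟩, rfl⟩
  · refine LipschitzWith.uniformEquicontinuous _ (Real.nnabs L) (fun f => ?_) |>.equicontinuous
    refine LipschitzWith.of_dist_le_mul fun x y => ?_
    rw [Real.dist_eq]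
    exact f.2.2 x y
  · rintro _ ⟨h, hh, rfl⟩
    refine ⟨fun x => ?_, fun x y => (hT h x y).trans
      (mul_le_mul_of_nonneg_right (hL h hh) dist_nonneg)⟩
    rw [mem_closedBall_zero_iff]
    exact ((T h).norm_coe_le_norm x).trans
      ((T.le_opNorm h).trans (mul_le_of_le_one_right (norm_nonneg _)
        (mem_closedBall_zero_iff.1 hh)))

variable {X : Type*} [TopologicalSpace X] {D : Set X}

lemma continuousOn_extend (h : C(D, ℝ)) :
    ContinuousOn (Function.extend Subtype.val h 0) D := by
  rw [continuousOn_iff_continuous_domRestrict]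
  have : D.domRestrict (Function.extend Subtype.val h 0) = h := by
    ext x
    exact Subtype.val_injective.extend_apply _ _ x
  rw [this]
  exact h.continuous

lemma extend_apply (h : C(D, ℝ)) (x : D) : Function.extend Subtype.val h 0 (x : X) = h x :=
  Subtype.val_injective.extend_apply _ _ x

variable {χ : ℝ → ℝ} {R : ℝ}

lemma abs_extend_le (h : C(closedBall (0 : EuclideanSpace ℝ (Fin 3)) R, ℝ)) :
    ∀ x ∈ closedBall (0 : EuclideanSpace ℝ (Fin 3)) R,
      |Function.extend Subtype.val h 0 x| ≤ ‖h‖ := fun x hx => by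
  rw [extend_apply h ⟨x, hx⟩]
  exact h.norm_coe_le_norm _

/-- The normalised cut-off Newtonian potential as an operator on continuous functions on a
closed ball. -/
noncomputable def newtonOp (hχ : Continuous χ) (hχb : ∀ η, 0 ≤ χ η ∧ χ η ≤ 1)
    (hχ0 : ∀ η, R ≤ η → χ η = 0) (hR : 0 ≤ R) :
    C(closedBall (0 : EuclideanSpace ℝ (Fin 3)) R, ℝ) →L[ℝ]
      C(closedBall (0 : EuclideanSpace ℝ (Fin 3)) R, ℝ) :=
  LinearMap.mkContinuous
    { toFun := fun h => ⟨fun x => newton3' χ (Function.extend Subtype.val h 0) x,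
        (LipschitzWith.of_dist_le_mul (K := Real.toNNReal (newtonConst R * ‖h‖)) fun x y => by
          rw [Real.dist_eq, Subtype.dist_eq, dist_eq_norm_sub, Real.coe_toNNReal _
            (mul_nonneg (newtonConst_nonneg R) (norm_nonneg _))]
          exact abs_newton3'_sub_le hχ hχb hχ0 (continuousOn_extend h) (norm_nonneg _)
            (abs_extend_le h) x.2 y.2).continuous⟩
      map_add' := fun h k => by
        ext x
        refine Eq.trans (congrFun (newton3'_congr hχ0 fun y hy => ?_) _)
          (newton3'_add hχ hχb hχ0 (continuousOn_extend h) (continuousOn_extend k) x)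
        simp only [extend_apply _ (⟨y, hy⟩ : closedBall (0 : EuclideanSpace ℝ (Fin 3)) R),
          ContinuousMap.add_apply]
      map_smul' := fun c h => by
        ext x
        refine Eq.trans (congrFun (newton3'_congr hχ0 fun y hy => ?_) _)
          (newton3'_const_mul c (x : EuclideanSpace ℝ (Fin 3)))
        simp only [extend_apply _ (⟨y, hy⟩ : closedBall (0 : EuclideanSpace ℝ (Fin 3)) R),
          ContinuousMap.smul_apply, smul_eq_mul] }
    (newtonConst R * R) fun h => by
      refine (ContinuousMap.norm_le _ (by have := newtonConst_nonneg R; positivity)).2 fun x => ?_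
      have := abs_newton3'_sub_le hχ hχb hχ0 (continuousOn_extend h) (norm_nonneg _)
            (abs_extend_le h) x.2 (mem_closedBall_self hR)
      rw [newton3'_zero_right, sub_zero, sub_zero] at this
      refine this.trans ?_
      rw [mul_right_comm]
      exact mul_le_mul_of_nonneg_right (mul_le_mul_of_nonneg_left
        (mem_closedBall_zero_iff.1 x.2) (newtonConst_nonneg R)) (norm_nonneg _)

variable (hχ : Continuous χ) (hχb : ∀ η, 0 ≤ χ η ∧ χ η ≤ 1)
    (hχ0 : ∀ η, R ≤ η → χ η = 0) (hR : 0 ≤ R)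

lemma newtonOp_apply {h : C(closedBall (0 : EuclideanSpace ℝ (Fin 3)) R, ℝ)}
    {f : EuclideanSpace ℝ (Fin 3) → ℝ}
    (hf : ∀ x : closedBall (0 : EuclideanSpace ℝ (Fin 3)) R, f x = h x)
    (x : closedBall (0 : EuclideanSpace ℝ (Fin 3)) R) :
    newtonOp hχ hχb hχ0 hR h x = newton3' χ f x :=
  congrFun (newton3'_congr hχ0 fun y hy => (extend_apply h ⟨y, hy⟩).trans (hf ⟨y, hy⟩).symm) _

lemma isCompactOperator_newtonOp : IsCompactOperator (newtonOp hχ hχb hχ0 hR) :=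
  isCompactOperator_of_lipschitz _ (L := newtonConst R) fun h x y => by
    rw [Subtype.dist_eq, dist_eq_norm_sub]
    exact abs_newton3'_sub_le hχ hχb hχ0 (continuousOn_extend h) (norm_nonneg _)
      (abs_extend_le h) x.2 y.2

/-- The Fredholm alternative for the integral equation `w = 𝒦 (V w + g)`: uniqueness for the
homogeneous equation yields unique solvability with a bound. -/
lemma exists_solution_of_kernel_trivial (hχ : Continuous χ) (hχb : ∀ η, 0 ≤ χ η ∧ χ η ≤ 1)
    (hχ0 : ∀ η, R ≤ η → χ η = 0) (hR : 0 ≤ R) {V : EuclideanSpace ℝ (Fin 3) → ℝ}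
    (hV : ContinuousOn V (closedBall 0 R))
    (hker : ∀ h : EuclideanSpace ℝ (Fin 3) → ℝ, ContinuousOn h (closedBall 0 R) →
      (∀ ξ ∈ closedBall (0 : EuclideanSpace ℝ (Fin 3)) R,
        h ξ = newton3' χ (fun y => V y * h y) ξ) →
      ∀ ξ ∈ closedBall (0 : EuclideanSpace ℝ (Fin 3)) R, h ξ = 0) :
    ∃ C : ℝ, ∀ g : EuclideanSpace ℝ (Fin 3) → ℝ, ContinuousOn g (closedBall 0 R) →
      ∃ w : EuclideanSpace ℝ (Fin 3) → ℝ, ContinuousOn w (closedBall 0 R) ∧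
        (∀ ξ ∈ closedBall (0 : EuclideanSpace ℝ (Fin 3)) R,
          w ξ = newton3' χ (fun y => V y * w y + g y) ξ) ∧
        (∀ w' : EuclideanSpace ℝ (Fin 3) → ℝ, ContinuousOn w' (closedBall 0 R) →
          (∀ ξ ∈ closedBall (0 : EuclideanSpace ℝ (Fin 3)) R,
            w' ξ = newton3' χ (fun y => V y * w' y + g y) ξ) →
          ∀ ξ ∈ closedBall (0 : EuclideanSpace ℝ (Fin 3)) R, w' ξ = w ξ) ∧
        ∀ B : ℝ, (∀ ξ ∈ closedBall (0 : EuclideanSpace ℝ (Fin 3)) R, |g ξ| ≤ B) →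
          ∀ ξ ∈ closedBall (0 : EuclideanSpace ℝ (Fin 3)) R, |w ξ| ≤ C * B := by
  let D := closedBall (0 : EuclideanSpace ℝ (Fin 3)) R
  let res : ∀ f : EuclideanSpace ℝ (Fin 3) → ℝ, ContinuousOn f D → C(D, ℝ) := fun f hf =>
    ⟨D.domRestrict f, hf.domRestrict⟩
  let K := newtonOp hχ hχb hχ0 hR
  let T : C(D, ℝ) →L[ℝ] C(D, ℝ) := K.comp (ContinuousLinearMap.mul ℝ C(D, ℝ) (res V hV))
  have hTc : IsCompactOperator T := (isCompactOperator_newtonOp hχ hχb hχ0 hR).comp_clm _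
  have hT : ∀ (h : C(D, ℝ)) (f : EuclideanSpace ℝ (Fin 3) → ℝ), (∀ x : D, f x = h x) →
      ∀ x : D, T h x = newton3' χ (fun y => V y * f y) x := fun h f hf x =>
    newtonOp_apply hχ hχb hχ0 hR (fun y => congrArg (V y * ·) (hf y)) x
  have hμ : (1 : ℝ) ∈ resolventSet ℝ T := by
    refine (hTc.hasEigenvalue_or_mem_resolventSet one_ne_zero).resolve_left fun he => ?_
    obtain ⟨h, hh⟩ := he.exists_hasEigenvector
    refine hh.2 (ContinuousMap.ext fun x => ?_)
    rw [← extend_apply h x]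
    refine hker _ (continuousOn_extend h) (fun ξ hξ => ?_) x x.2
    rw [← hT h _ (extend_apply h) ⟨ξ, hξ⟩, extend_apply h ⟨ξ, hξ⟩]
    have := hh.apply_eq_smul
    rw [one_smul] at this
    exact (congrArg (fun k : C(D, ℝ) => k ⟨ξ, hξ⟩) this).symm
  rw [spectrum.mem_resolventSet_iff, map_one] at hμ
  obtain ⟨u, hu⟩ := hμ
  let S : C(D, ℝ) →L[ℝ] C(D, ℝ) := ↑u⁻¹
  have hS : ∀ h, S h - T (S h) = h := fun h => by
    have := congrArg (fun A : C(D, ℝ) →L[ℝ] C(D, ℝ) => A h) u.mul_inv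
    rwa [hu] at this
  have hS' : ∀ h, S (h - T h) = h := fun h => by
    have := congrArg (fun A : C(D, ℝ) →L[ℝ] C(D, ℝ) => A h) u.inv_mul
    rwa [hu] at this
  have heq : ∀ (g : EuclideanSpace ℝ (Fin 3) → ℝ) (hg : ContinuousOn g D) (h : C(D, ℝ))
      (f : EuclideanSpace ℝ (Fin 3) → ℝ) (hf : ∀ x : D, f x = h x) (x : D),
      newton3' χ (fun y => V y * f y + g y) x = T h x + K (res g hg) x := fun g hg h f hf x => by
    have hfc : ContinuousOn f D := by
      rw [continuousOn_iff_continuous_domRestrict]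
      convert h.continuous using 1
      exact funext hf
    rw [hT h f hf, newtonOp_apply hχ hχb hχ0 hR (f := g) (fun y => rfl)]
    exact newton3'_add hχ hχb hχ0 (hV.mul hfc) hg x
  refine ⟨‖S‖ * ‖K‖, fun g hg => ?_⟩
  let w := S (K (res g hg))
  refine ⟨Function.extend Subtype.val w 0, continuousOn_extend w, fun ξ hξ => ?_,
    fun w' hw' hw'e ξ hξ => ?_, fun B hB ξ hξ => ?_⟩
  · rw [extend_apply w ⟨ξ, hξ⟩, heq g hg w _ (extend_apply w) ⟨ξ, hξ⟩]
    have := congrArg (fun k : C(D, ℝ) => k ⟨ξ, hξ⟩) (hS (K (res g hg)))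
    simp only [ContinuousMap.sub_apply] at this
    linarith
  · have : res w' hw' - T (res w' hw') = K (res g hg) := by
      ext x
      rw [ContinuousMap.sub_apply, sub_eq_iff_eq_add',
        ← heq g hg (res w' hw') w' (fun y => rfl) x]
      exact hw'e x x.2
    rw [extend_apply w ⟨ξ, hξ⟩]
    have h2 := hS' (res w' hw')
    rw [this] at h2
    exact (congrArg (fun k : C(D, ℝ) => k ⟨ξ, hξ⟩) h2).symm
  · have hB0 : 0 ≤ B := (abs_nonneg _).trans (hB ξ hξ)
    refine (abs_extend_le w ξ hξ).trans ((S.le_opNorm _).trans ?_)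
    rw [mul_assoc]
    refine mul_le_mul_of_nonneg_left ((K.le_opNorm _).trans
      (mul_le_mul_of_nonneg_left ?_ (norm_nonneg _))) (norm_nonneg _)
    exact (ContinuousMap.norm_le _ hB0).2 fun x => hB x x.2

end Fredholm

section Holder

variable {E : Type*} [NormedAddCommGroup E] {f g : E → ℝ} {s : Set E} {A B H K α : ℝ}

lemma continuousOn_of_holder (hα : 0 < α)
    (hf : ∀ x ∈ s, ∀ y ∈ s, |f x - f y| ≤ H * ‖x - y‖ ^ α) : ContinuousOn f s := by
  intro x hx
  rw [ContinuousWithinAt, tendsto_iff_norm_sub_tendsto_zero]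
  refine squeeze_zero' (.of_forall fun _ => norm_nonneg _)
    (eventually_mem_nhdsWithin.mono fun y hy => hf y hy x hx) ?_
  have : Tendsto (fun y : E => H * ‖y - x‖ ^ α) (𝓝 x) (𝓝 (H * ‖x - x‖ ^ α)) :=
    Continuous.tendsto (continuous_const.mul
      ((by fun_prop : Continuous fun y : E => ‖y - x‖).rpow_const fun _ => .inr hα.le)) x
  rw [sub_self, norm_zero, Real.zero_rpow hα.ne', mul_zero] at this
  exact this.mono_left nhdsWithin_le_nhds

lemma holder_add (hf : ∀ x ∈ s, ∀ y ∈ s, |f x - f y| ≤ H * ‖x - y‖ ^ α)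
    (hg : ∀ x ∈ s, ∀ y ∈ s, |g x - g y| ≤ K * ‖x - y‖ ^ α) :
    ∀ x ∈ s, ∀ y ∈ s, |(f x + g x) - (f y + g y)| ≤ (H + K) * ‖x - y‖ ^ α := by
  intro x hx y hy
  rw [add_sub_add_comm, add_mul]
  exact (abs_add_le _ _).trans (add_le_add (hf x hx y hy) (hg x hx y hy))

lemma holder_mul (hfA : ∀ x ∈ s, |f x| ≤ A) (hgB : ∀ x ∈ s, |g x| ≤ B)
    (hf : ∀ x ∈ s, ∀ y ∈ s, |f x - f y| ≤ H * ‖x - y‖ ^ α)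
    (hg : ∀ x ∈ s, ∀ y ∈ s, |g x - g y| ≤ K * ‖x - y‖ ^ α) :
    ∀ x ∈ s, ∀ y ∈ s, |f x * g x - f y * g y| ≤ (A * K + H * B) * ‖x - y‖ ^ α := by
  intro x hx y hy
  have hA : 0 ≤ A := (abs_nonneg _).trans (hfA x hx)
  have e : f x * g x - f y * g y = f x * (g x - g y) + (f x - f y) * g y := by ring
  have h1 := mul_le_mul (hfA x hx) (hg x hx y hy) (abs_nonneg _) hA
  have h2 := mul_le_mul (hf x hx y hy) (hgB y hy) (abs_nonneg _)
    ((abs_nonneg _).trans (hf x hx y hy))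
  rw [e]
  refine (abs_add_le _ _).trans ?_
  rw [abs_mul, abs_mul]
  linarith

lemma holder_of_lipschitz {L R : ℝ} (hL : 0 ≤ L) (hα0 : 0 ≤ α) (hα1 : α ≤ 1)
    (hf : ∀ x ∈ closedBall (0 : E) R, ∀ y ∈ closedBall (0 : E) R, |f x - f y| ≤ L * ‖x - y‖) :
    ∀ x ∈ closedBall (0 : E) R, ∀ y ∈ closedBall (0 : E) R,
      |f x - f y| ≤ L * (2 * R) ^ (1 - α) * ‖x - y‖ ^ α := by
  intro x hx y hy
  refine (hf x hx y hy).trans ?_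
  rw [mul_assoc]
  refine mul_le_mul_of_nonneg_left ?_ hL
  have hd : ‖x - y‖ ≤ 2 * R := by
    rw [mem_closedBall_zero_iff] at hx hy
    linarith [norm_sub_le x y]
  calc ‖x - y‖ = ‖x - y‖ ^ (1 - α) * ‖x - y‖ ^ α := by
        rw [← Real.rpow_add_of_nonneg (norm_nonneg _) (by linarith) hα0, sub_add_cancel,
          Real.rpow_one]
    _ ≤ _ := mul_le_mul_of_nonneg_right
        (Real.rpow_le_rpow (norm_nonneg _) hd (by linarith)) (by positivity)

lemma holder_of_eq_zero {M ρ R : ℝ} (hρ : ρ < R) (hα0 : 0 ≤ α)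
    (hfM : ∀ x, |f x| ≤ M) (hf0 : ∀ x, ρ ≤ ‖x‖ → f x = 0) (hH : 0 ≤ H)
    (hf : ∀ x ∈ closedBall (0 : E) R, ∀ y ∈ closedBall (0 : E) R,
      |f x - f y| ≤ H * ‖x - y‖ ^ α) (x y : E) :
    |f x - f y| ≤ (H + M * ((R - ρ) ^ α)⁻¹) * ‖x - y‖ ^ α := by
  have hM : 0 ≤ M := (abs_nonneg _).trans (hfM 0)
  have hp : 0 < (R - ρ) ^ α := Real.rpow_pos_of_pos (sub_pos.2 hρ) α
  have key : ∀ x y : E, R < ‖y‖ → |f x| ≤ (H + M * ((R - ρ) ^ α)⁻¹) * ‖x - y‖ ^ α := by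
    intro x y hy
    rcases le_or_gt ρ ‖x‖ with hx | hx
    · rw [hf0 x hx, abs_zero]
      positivity
    · have hd : (R - ρ) ^ α ≤ ‖x - y‖ ^ α := by
        refine Real.rpow_le_rpow (sub_nonneg.2 hρ.le) ?_ hα0
        have := norm_sub_norm_le y x
        rw [norm_sub_rev] at this
        linarith
      calc |f x| ≤ M := hfM x
        _ = M * ((R - ρ) ^ α)⁻¹ * (R - ρ) ^ α := by field_simp
        _ ≤ M * ((R - ρ) ^ α)⁻¹ * ‖x - y‖ ^ α :=
          mul_le_mul_of_nonneg_left hd (by positivity)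
        _ ≤ _ := mul_le_mul_of_nonneg_right (le_add_of_nonneg_left hH) (by positivity)
  rcases le_or_gt ‖y‖ R with hy | hy
  · rcases le_or_gt ‖x‖ R with hx | hx
    · refine (hf x (mem_closedBall_zero_iff.2 hx) y (mem_closedBall_zero_iff.2 hy)).trans
        (mul_le_mul_of_nonneg_right (le_add_of_nonneg_right (by positivity)) (by positivity))
    · rw [hf0 x (hρ.le.trans hx.le), zero_sub, abs_neg, norm_sub_rev]
      exact key y x hx
  · rw [hf0 y (hρ.le.trans hy.le), sub_zero]
    exact key x y hy

lemma exists_lipschitz_comp_norm {χ : ℝ → ℝ} (hχ : ContDiff ℝ 1 χ) (R : ℝ) :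
    ∃ L : ℝ, 0 ≤ L ∧ ∀ x ∈ closedBall (0 : E) R, ∀ y ∈ closedBall (0 : E) R,
      |χ ‖x‖ - χ ‖y‖| ≤ L * ‖x - y‖ := by
  obtain ⟨L, hL⟩ := hχ.locallyLipschitz.locallyLipschitzOn.exists_lipschitzOnWith_of_compact
    (isCompact_Icc (a := (0 : ℝ)) (b := R))
  refine ⟨L, L.2, fun x hx y hy => ?_⟩
  have := hL.dist_le_mul ‖x‖ ⟨norm_nonneg x, mem_closedBall_zero_iff.1 hx⟩ ‖y‖
    ⟨norm_nonneg y, mem_closedBall_zero_iff.1 hy⟩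
  exact this.trans (mul_le_mul_of_nonneg_left (abs_norm_sub_norm_le x y) L.2)

end Holder

section Regularity

lemma laplacian3_const_mul_sub_const (c a : ℝ) (U : EuclideanSpace ℝ (Fin 3) → ℝ)
    (x : EuclideanSpace ℝ (Fin 3)) :
    laplacian3 (fun y => c * (U y - a)) x = c * laplacian3 U x := by
  have hc : ∀ F : EuclideanSpace ℝ (Fin 3) → ℝ,
      fderiv ℝ (fun y => c * F y) = c • fderiv ℝ F := fun F => fderiv_const_smul_field c
  have h : fderiv ℝ (fun y => U y - a) = fderiv ℝ U := funext fun y => fderiv_sub_const a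
  simp only [laplacian3, hc, h, Pi.smul_apply, _root_.smul_apply, smul_eq_mul,
    Finset.mul_sum]

variable {χ : ℝ → ℝ} {f : EuclideanSpace ℝ (Fin 3) → ℝ} {α H ρ R : ℝ}

/-- Interior regularity for the cut-off Newtonian potential of a Hölder continuous density. -/
lemma poisson_newton3' (hχ : ContDiff ℝ 1 χ) (hχb : ∀ η, 0 ≤ χ η ∧ χ η ≤ 1)
    (hχ0 : ∀ η, ρ ≤ η → χ η = 0) (hR : 0 < R) (hρ : ρ < R) (hα0 : 0 < α) (hα1 : α ≤ 1)
    (hf : ∀ x ∈ closedBall (0 : EuclideanSpace ℝ (Fin 3)) R,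
      ∀ y ∈ closedBall (0 : EuclideanSpace ℝ (Fin 3)) R, |f x - f y| ≤ H * ‖x - y‖ ^ α) :
    ContDiffOn ℝ 2 (newton3' χ f) (ball 0 R) ∧
      ∀ x, ‖x‖ < R → laplacian3 (newton3' χ f) x = -(f x * χ ‖x‖) := by
  have hχ0' : ∀ η, R ≤ η → χ η = 0 := fun η hη => hχ0 η (hρ.le.trans hη)
  have hfc := continuousOn_of_holder hα0 hf
  obtain ⟨M', hM'⟩ :=
    (isCompact_closedBall (0 : EuclideanSpace ℝ (Fin 3)) R).exists_bound_of_continuousOn hfc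
  obtain ⟨M, hM, hfM⟩ : ∃ M, 0 ≤ M ∧ ∀ x ∈ closedBall (0 : EuclideanSpace ℝ (Fin 3)) R, |f x| ≤ M :=
    ⟨max M' 0, le_max_right _ _, fun x hx => (hM' x hx).trans (le_max_left _ _)⟩
  obtain ⟨L, hL, hχL⟩ := exists_lipschitz_comp_norm (E := EuclideanSpace ℝ (Fin 3)) hχ R
  have hloc := holder_mul hfM (fun x _ => by rw [abs_of_nonneg (hχb _).1]; exact (hχb ‖x‖).2) hf
    (holder_of_lipschitz hL hα0.le hα1 hχL)
  have hbd := abs_mul_cutoff_le hχb hχ0' hM hfM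
  have hglob := holder_of_eq_zero hρ hα0.le hbd (fun x hx => by rw [hχ0 _ hx, mul_zero])
    (abs_nonneg _) fun x hx y hy => (hloc x hx y hy).trans
      (mul_le_mul_of_nonneg_right (le_abs_self _) (by positivity))
  have hcont : Continuous fun x : EuclideanSpace ℝ (Fin 3) => f x * χ ‖x‖ :=
    continuousOn_univ.1 (continuousOn_of_holder hα0 fun x _ y _ => hglob x y)
  have hp : 0 < (R - ρ) ^ α := Real.rpow_pos_of_pos (sub_pos.2 hρ) α
  obtain ⟨hU, hΔ⟩ := poisson_of_holder hcont hbd hα0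
    (add_nonneg (abs_nonneg _) (by positivity)) hglob hR
    (fun x hx => by rw [hχ0' _ hx, mul_zero]) (integrable_newton3 hχ.continuous hχb hχ0' hfc)
  have e : newton3' χ f = fun x => 1 / (4 * Real.pi) *
      ((∫ t, f t * χ ‖t‖ / ‖x - t‖) - ∫ t, f t * χ ‖t‖ / ‖(0 : EuclideanSpace ℝ (Fin 3)) - t‖) := by
    ext x
    rw [newton3', newton3, newton3, mul_sub]
  rw [e]
  refine ⟨contDiffOn_const.mul (hU.sub contDiffOn_const), fun x hx => ?_⟩
  rw [laplacian3_const_mul_sub_const, hΔ x hx]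
  field_simp

end Regularity

end NewtonPotential

/-- Proposition of §4.3: the Poisson-type equation with the negative potential
−(1/(γ−1))(Θ ∨ 0)^q.  Under the kernel condition, for every α-Hölder continuous
g there is a unique continuous solution W of the integral equation
W = 𝒦[(1/(γ−1))(Θ ∨ 0)^q W + g]; it vanishes at the origin, is C² on the open
ball of radius Ξ, solves ΔW + (1/(γ−1))(Θ ∨ 0)^q W + g = 0 there, and satisfies
sup|W| ≤ C sup|g| with C independent of g. -/
theorem poisson_negative_potential
    (γ α Ξ Ξ₀ : ℝ) (hγ1 : 6 / 5 < γ) (hγ2 : γ < 2)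
    (hα : 0 < α) (hα2 : α < min (1 / (γ - 1) - 1) 1)
    (hΞ : 0 < Ξ) (hΞΞ₀ : Ξ < Ξ₀)
    (χ : ℝ → ℝ) (hχsm : ContDiff ℝ (⊤ : ℕ∞) χ)
    (hχ1 : ∀ η : ℝ, η ≤ Ξ → χ η = 1)
    (hχ0 : ∀ η : ℝ, (Ξ + Ξ₀) / 2 ≤ η → χ η = 0)
    (hχb : ∀ η : ℝ, 0 ≤ χ η ∧ χ η ≤ 1)
    (Θ : EuclideanSpace ℝ (Fin 3) → ℝ)
    (hΘc : ContinuousOn Θ (Metric.closedBall 0 Ξ₀))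
    (hΘH : ∃ H : ℝ, ∀ x ∈ Metric.closedBall (0 : EuclideanSpace ℝ (Fin 3)) Ξ₀,
      ∀ y ∈ Metric.closedBall (0 : EuclideanSpace ℝ (Fin 3)) Ξ₀,
        |max (Θ x) 0 ^ (1 / (γ - 1) - 1) - max (Θ y) 0 ^ (1 / (γ - 1) - 1)|
          ≤ H * ‖x - y‖ ^ α)
    (hker : ∀ h : EuclideanSpace ℝ (Fin 3) → ℝ,
      ContinuousOn h (Metric.closedBall 0 Ξ₀) →
      (∀ ξ ∈ Metric.closedBall (0 : EuclideanSpace ℝ (Fin 3)) Ξ₀,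
        h ξ = newton3' χ
          (fun y => (1 / (γ - 1)) * max (Θ y) 0 ^ (1 / (γ - 1) - 1) * h y) ξ) →
      ∀ ξ ∈ Metric.closedBall (0 : EuclideanSpace ℝ (Fin 3)) Ξ₀, h ξ = 0) :
    ∃ C : ℝ, ∀ g : EuclideanSpace ℝ (Fin 3) → ℝ,
      (∃ H : ℝ, ∀ x ∈ Metric.closedBall (0 : EuclideanSpace ℝ (Fin 3)) Ξ₀,
        ∀ y ∈ Metric.closedBall (0 : EuclideanSpace ℝ (Fin 3)) Ξ₀,
          |g x - g y| ≤ H * ‖x - y‖ ^ α) →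
      ∃ W : EuclideanSpace ℝ (Fin 3) → ℝ,
        ContinuousOn W (Metric.closedBall 0 Ξ₀) ∧
        (∀ ξ ∈ Metric.closedBall (0 : EuclideanSpace ℝ (Fin 3)) Ξ₀,
          W ξ = newton3' χ
            (fun y => (1 / (γ - 1)) * max (Θ y) 0 ^ (1 / (γ - 1) - 1) * W y + g y) ξ) ∧
        (∀ W' : EuclideanSpace ℝ (Fin 3) → ℝ,
          ContinuousOn W' (Metric.closedBall 0 Ξ₀) →
          (∀ ξ ∈ Metric.closedBall (0 : EuclideanSpace ℝ (Fin 3)) Ξ₀,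
            W' ξ = newton3' χ
              (fun y => (1 / (γ - 1)) * max (Θ y) 0 ^ (1 / (γ - 1) - 1) * W' y + g y) ξ) →
          ∀ ξ ∈ Metric.closedBall (0 : EuclideanSpace ℝ (Fin 3)) Ξ₀, W' ξ = W ξ) ∧
        W 0 = 0 ∧
        ContDiffOn ℝ 2 W (Metric.ball 0 Ξ) ∧
        (∀ ξ : EuclideanSpace ℝ (Fin 3), ‖ξ‖ < Ξ →
          laplacian3 W ξ + (1 / (γ - 1)) * max (Θ ξ) 0 ^ (1 / (γ - 1) - 1) * W ξ + g ξ = 0) ∧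
        (∀ B : ℝ, (∀ ξ ∈ Metric.closedBall (0 : EuclideanSpace ℝ (Fin 3)) Ξ₀, |g ξ| ≤ B) →
          ∀ ξ ∈ Metric.closedBall (0 : EuclideanSpace ℝ (Fin 3)) Ξ₀, |W ξ| ≤ C * B) := by
  let V : EuclideanSpace ℝ (Fin 3) → ℝ := fun y =>
    (1 / (γ - 1)) * max (Θ y) 0 ^ (1 / (γ - 1) - 1)
  have hα1 : α ≤ 1 := (hα2.trans_le (min_le_right _ _)).le
  have hΞ₀ : 0 < Ξ₀ := hΞ.trans hΞΞ₀
  have hρ : (Ξ + Ξ₀) / 2 < Ξ₀ := by linarith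
  have hχ0' : ∀ η : ℝ, Ξ₀ ≤ η → χ η = 0 := fun η hη => hχ0 η (hρ.le.trans hη)
  have hχc : Continuous χ := hχsm.continuous
  obtain ⟨H, hH⟩ := hΘH
  have hVH : ∀ x ∈ Metric.closedBall (0 : EuclideanSpace ℝ (Fin 3)) Ξ₀,
      ∀ y ∈ Metric.closedBall (0 : EuclideanSpace ℝ (Fin 3)) Ξ₀,
        |V x - V y| ≤ |1 / (γ - 1)| * H * ‖x - y‖ ^ α := fun x hx y hy => by
    rw [← mul_sub, abs_mul, mul_assoc]
    exact mul_le_mul_of_nonneg_left (hH x hx y hy) (abs_nonneg _)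
  have hVc := NewtonPotential.continuousOn_of_holder hα hVH
  obtain ⟨A, hA⟩ :=
    (isCompact_closedBall (0 : EuclideanSpace ℝ (Fin 3)) Ξ₀).exists_bound_of_continuousOn hVc
  obtain ⟨C, hC⟩ :=
    NewtonPotential.exists_solution_of_kernel_trivial hχc hχb hχ0' hΞ₀.le hVc hker
  refine ⟨C, fun g ⟨G, hG⟩ => ?_⟩
  have hgc := NewtonPotential.continuousOn_of_holder hα hG
  obtain ⟨w, hwc, hw, hwu, hwB⟩ := hC g hgc
  let F : EuclideanSpace ℝ (Fin 3) → ℝ := fun y => V y * w y + g y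
  have hFc : ContinuousOn F (Metric.closedBall 0 Ξ₀) := (hVc.mul hwc).add hgc
  obtain ⟨M, hM⟩ :=
    (isCompact_closedBall (0 : EuclideanSpace ℝ (Fin 3)) Ξ₀).exists_bound_of_continuousOn hFc
  obtain ⟨B, hB⟩ :=
    (isCompact_closedBall (0 : EuclideanSpace ℝ (Fin 3)) Ξ₀).exists_bound_of_continuousOn hwc
  have hM0 : 0 ≤ M := (norm_nonneg _).trans (hM 0 (Metric.mem_closedBall_self hΞ₀.le))
  have hwH := NewtonPotential.holder_of_lipschitz (f := w)
    (mul_nonneg (NewtonPotential.newtonConst_nonneg Ξ₀) hM0) hα.le hα1 fun x hx y hy => by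
      rw [hw x hx, hw y hy]
      exact NewtonPotential.abs_newton3'_sub_le hχc hχb hχ0' hFc hM0 hM hx hy
  obtain ⟨hreg, hΔ⟩ := NewtonPotential.poisson_newton3' (hχsm.of_le (by norm_cast))
    hχb hχ0 hΞ₀ hρ hα hα1
    (NewtonPotential.holder_add (NewtonPotential.holder_mul hA hB hVH hwH) hG)
  have hWw : Set.EqOn w (newton3' χ F) (Metric.closedBall 0 Ξ₀) := hw
  refine ⟨newton3' χ F, hwc.congr hWw.symm, fun ξ _ => ?_, fun W' hW'c hW' ξ hξ => ?_,
    NewtonPotential.newton3'_zero_right, hreg.mono (Metric.ball_subset_ball hΞΞ₀.le),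
    fun ξ hξ => ?_, fun b hb ξ hξ => ?_⟩
  · refine congrFun (NewtonPotential.newton3'_congr hχ0' fun y hy => ?_) ξ
    simp only [F, V, hWw hy]
  · rw [← hWw hξ]
    exact hwu W' hW'c hW' ξ hξ
  · have hξ' : ξ ∈ Metric.closedBall (0 : EuclideanSpace ℝ (Fin 3)) Ξ₀ :=
      mem_closedBall_zero_iff.2 (hξ.trans hΞΞ₀).le
    rw [hΔ ξ (hξ.trans hΞΞ₀), ← hWw hξ', hχ1 _ hξ.le]
    ring
  · rw [← hWw hξ]
    exact hwB b hb ξ hξ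
end

section
/- There exists a constant C, depending only on γ and κ, such that for all bounded functions w₁, w₂ : S → ℝ, sup_{x ∈ S} |H_ρ(w₂)(x) − H_ρ(w₁)(x)| ≤ C·((‖w₁‖ + ‖w₂‖)/c²)^{1/(γ−1) − 1}·‖w₂ − w₁‖/c², where ‖·‖ denotes the sup norm on S. -/
theorem Real.abs_rpow_sub_rpow_le {q a b : ℝ} (hq0 : 0 ≤ q) (hq1 : q ≤ 1) (ha : 0 ≤ a)
    (hb : 0 ≤ b) : |a ^ q - b ^ q| ≤ |a - b| ^ q := by
  wlog hab : b ≤ a generalizing a b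
  · rw [abs_sub_comm, abs_sub_comm a b]
    exact this hb ha (le_of_not_ge hab)
  rw [abs_of_nonneg (sub_nonneg.2 (Real.rpow_le_rpow hb hab hq0)),
    abs_of_nonneg (sub_nonneg.2 hab)]
  have h := Real.rpow_add_le_add_rpow (sub_nonneg.2 hab) hb hq0 hq1
  rw [sub_add_cancel] at h
  linarith

theorem Real.hasDerivAt_max_zero_rpow {p : ℝ} (hp : 1 < p) (u : ℝ) :
    HasDerivAt (fun v : ℝ => max v 0 ^ p) (p * max u 0 ^ (p - 1)) u := by
  have h_cont (q : ℝ) (hq : 0 ≤ q) : Continuous fun v : ℝ => max v 0 ^ q :=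
    (continuous_id.max continuous_const).rpow_const fun _ => Or.inr hq
  refine hasDerivAt_of_hasDerivAt_of_ne' (x := 0)
    (g := fun v => p * max v 0 ^ (p - 1)) (fun v hv => ?_)
    (h_cont p (by linarith)).continuousAt
    (continuous_const.mul (h_cont (p - 1) (by linarith))).continuousAt u
  rcases lt_or_gt_of_ne hv with hv | hv
  · rw [max_eq_right hv.le, Real.zero_rpow (by linarith), mul_zero]
    refine (hasDerivAt_const v (0 : ℝ)).congr_of_eventuallyEq ?_
    filter_upwards [Iio_mem_nhds hv] with y hy
    rw [max_eq_right (Set.mem_Iio.1 hy).le, Real.zero_rpow (by linarith)]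
  · rw [max_eq_left hv.le]
    refine (Real.hasDerivAt_rpow_const (Or.inl hv.ne')).congr_of_eventuallyEq ?_
    filter_upwards [Ioi_mem_nhds hv] with y hy
    rw [max_eq_left (Set.mem_Ioi.1 hy).le]

/-- The first-order Taylor remainder of `v ↦ (v ∨ 0) ^ p` at `u` is Lipschitz on `[-R, R]`, with
a constant of order `R ^ (p - 1)`. -/
theorem Real.abs_max_zero_rpow_sub_sub_le {p : ℝ} (hp1 : 1 < p) (hp2 : p ≤ 2) {u v₁ v₂ R : ℝ}
    (h₁ : |v₁| ≤ R) (h₂ : |v₂| ≤ R) :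
    |max (u + v₂) 0 ^ p - max (u + v₁) 0 ^ p - p * max u 0 ^ (p - 1) * (v₂ - v₁)|
      ≤ p * R ^ (p - 1) * |v₂ - v₁| := by
  have h_deriv (v : ℝ) : HasDerivAt
      (fun v : ℝ => max (u + v) 0 ^ p - p * max u 0 ^ (p - 1) * v)
      (p * max (u + v) 0 ^ (p - 1) - p * max u 0 ^ (p - 1)) v := by
    have h := ((Real.hasDerivAt_max_zero_rpow hp1 (u + v)).comp_const_add u v).sub
      ((hasDerivAt_id v).const_mul (p * max u 0 ^ (p - 1)))
    rwa [mul_one] at h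
  have h_bound (v : ℝ) (hv : v ∈ Set.Icc (-R) R) :
      ‖p * max (u + v) 0 ^ (p - 1) - p * max u 0 ^ (p - 1)‖ ≤ p * R ^ (p - 1) := by
    rw [← mul_sub, Real.norm_eq_abs, abs_mul, abs_of_pos (by linarith : 0 < p)]
    refine mul_le_mul_of_nonneg_left ?_ (by linarith)
    refine (Real.abs_rpow_sub_rpow_le (by linarith) (by linarith) (le_max_right _ _)
      (le_max_right _ _)).trans ?_
    refine Real.rpow_le_rpow (abs_nonneg _) ?_ (by linarith)
    refine (abs_max_sub_max_le_abs (u + v) u 0).trans ?_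
    rw [add_sub_cancel_left]
    exact abs_le.2 hv
  have h := (convex_Icc (-R) R).norm_image_sub_le_of_norm_hasDerivWithin_le
    (fun v _ => (h_deriv v).hasDerivWithinAt) h_bound (abs_le.1 h₁) (abs_le.1 h₂)
  simp only [Real.norm_eq_abs] at h
  convert h using 2
  ring

/-- Proposition 11 ii), estimate (5.14):
sup|H_ρ(w₂) − H_ρ(w₁)| ≤ C((‖w₁‖ + ‖w₂‖)/c²)^{1/(γ−1)−1}·‖w₂ − w₁‖/c² with a
constant C depending only on γ and κ, where
H_ρ(w) = f_ρ(u_N + w/c²) − f_ρ(u_N) − Df_ρ(u_N)·w/c² and f_ρ(u) = κ(u ∨ 0)^{1/(γ−1)}. -/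
theorem Hrho_difference_estimate
    (γ κ : ℝ) (hγ1 : 3 / 2 ≤ γ) (hγ2 : γ < 2) (hκ : 0 < κ) :
    ∃ C : ℝ, ∀ (S : Type) (_ : Nonempty S) (c : ℝ), 0 < c →
      ∀ uN : S → ℝ, (∃ M : ℝ, ∀ x : S, |uN x| ≤ M) →
      ∀ (w₁ w₂ : S → ℝ) (B₁ B₂ B₁₂ : ℝ),
        (∀ x : S, |w₁ x| ≤ B₁) → (∀ x : S, |w₂ x| ≤ B₂) →
        (∀ x : S, |w₂ x - w₁ x| ≤ B₁₂) →
      ∀ x : S,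
        |(κ * max (uN x + w₂ x / c ^ 2) 0 ^ (1 / (γ - 1))
            - κ * max (uN x) 0 ^ (1 / (γ - 1))
            - (1 / (γ - 1)) * κ * max (uN x) 0 ^ (1 / (γ - 1) - 1) * (w₂ x / c ^ 2))
          - (κ * max (uN x + w₁ x / c ^ 2) 0 ^ (1 / (γ - 1))
            - κ * max (uN x) 0 ^ (1 / (γ - 1))
            - (1 / (γ - 1)) * κ * max (uN x) 0 ^ (1 / (γ - 1) - 1) * (w₁ x / c ^ 2))|
          ≤ C * ((B₁ + B₂) / c ^ 2) ^ (1 / (γ - 1) - 1) * (B₁₂ / c ^ 2) := by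
  have hp1 : 1 < 1 / (γ - 1) := by rw [lt_div_iff₀ (by linarith)]; linarith
  have hp2 : 1 / (γ - 1) ≤ 2 := by rw [div_le_iff₀ (by linarith)]; linarith
  generalize 1 / (γ - 1) = p at hp1 hp2 ⊢
  refine ⟨κ * p, fun S _ c hc uN _ w₁ w₂ B₁ B₂ B₁₂ hB₁ hB₂ hB₁₂ x => ?_⟩
  have hc2 : 0 < c ^ 2 := by positivity
  have hB₁0 : 0 ≤ B₁ := (abs_nonneg _).trans (hB₁ x)
  have hB₂0 : 0 ≤ B₂ := (abs_nonneg _).trans (hB₂ x)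
  have h_abs_div (a : ℝ) : |a / c ^ 2| = |a| / c ^ 2 := by rw [abs_div, abs_of_pos hc2]
  have h₁ : |w₁ x / c ^ 2| ≤ (B₁ + B₂) / c ^ 2 := by
    rw [h_abs_div]; gcongr; linarith [hB₁ x]
  have h₂ : |w₂ x / c ^ 2| ≤ (B₁ + B₂) / c ^ 2 := by
    rw [h_abs_div]; gcongr; linarith [hB₂ x]
  have h₁₂ : |w₂ x / c ^ 2 - w₁ x / c ^ 2| ≤ B₁₂ / c ^ 2 := by
    rw [← sub_div, h_abs_div]; gcongr; exact hB₁₂ x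
  calc
    _ = κ * |max (uN x + w₂ x / c ^ 2) 0 ^ p - max (uN x + w₁ x / c ^ 2) 0 ^ p
          - p * max (uN x) 0 ^ (p - 1) * (w₂ x / c ^ 2 - w₁ x / c ^ 2)| := by
      rw [← abs_of_pos hκ, ← abs_mul, abs_of_pos hκ]
      congr 1
      ring
    _ ≤ κ * (p * ((B₁ + B₂) / c ^ 2) ^ (p - 1) * |w₂ x / c ^ 2 - w₁ x / c ^ 2|) := by
      gcongr
      exact Real.abs_max_zero_rpow_sub_sub_le hp1 hp2 h₁ h₂
    _ ≤ κ * (p * ((B₁ + B₂) / c ^ 2) ^ (p - 1) * (B₁₂ / c ^ 2)) := by gcongr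
    _ = κ * p * ((B₁ + B₂) / c ^ 2) ^ (p - 1) * (B₁₂ / c ^ 2) := by ring
end
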